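/- arXiv:math/0703434 — 2 statements merged into one kernel-verified Lean document; each statement's English description precedes it below -/
import Mathlib

section
/- There exist constants c > 0 and c_− > 0 such that for every integer n ≥ 3, f^w_{0,0}(n) ≥ (c / n^{c_−}) · f^p_{0,0}(n); equivalently, the conditional probability that the integrated walk stays nonnegative given that it ends with a double zero is at least c/n^{c_−}. -/
open MeasureTheory Filter Topology Set
open scoped ENNReal NNReal BigOperators

noncomputable section

/-- The configuration `φ_{-1} = x, φ_0 = 0, (φ_1,…,φ_{n-2}) = w, φ_{n-1} = y, φ_n = 0`
extended to `ℤ`. -/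
def fExt (x y : ℝ) (n : ℕ) (w : Fin (n - 2) → ℝ) (i : ℤ) : ℝ :=
  if h1 : i ≤ -1 then x
  else if h2 : i = 0 then 0
  else if h : i ≤ (n : ℤ) - 2 then w ⟨i.toNat - 1, by omega⟩
  else if i = (n : ℤ) - 1 then y else 0

/-- the pinning density `f^p_{x,y}(n)` -/
def fpin (E : ℝ → ℝ) (x y : ℝ) (n : ℕ) : ℝ :=
  if n = 1 then (if y = 0 then E x else 0)
  else if y = 0 then 0
  else ∫ w : Fin (n - 2) → ℝ,
    ∏ m ∈ Finset.Icc (0 : ℤ) ((n : ℤ) - 1),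
      E (fExt x y n w (m + 1) + fExt x y n w (m - 1) - 2 * fExt x y n w m)

/-- the wetting density `f^w_{x,y}(n)` -/
def fwet (E : ℝ → ℝ) (x y : ℝ) (n : ℕ) : ℝ :=
  if 0 ≤ x ∧ 0 ≤ y then
    (if n = 1 then (if y = 0 then E x else 0)
    else if y = 0 then 0
    else ∫ w in {w : Fin (n - 2) → ℝ | ∀ i, 0 ≤ w i},
      ∏ m ∈ Finset.Icc (0 : ℤ) ((n : ℤ) - 1),
        E (fExt x y n w (m + 1) + fExt x y n w (m - 1) - 2 * fExt x y n w m))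
  else 0

/-- `f^p_{0,0}(n)` without the indicator `1_{(y ≠ 0)}` -/
def fpinZero (E : ℝ → ℝ) (n : ℕ) : ℝ :=
  ∫ w : Fin (n - 2) → ℝ,
    ∏ m ∈ Finset.Icc (0 : ℤ) ((n : ℤ) - 1),
      E (fExt 0 0 n w (m + 1) + fExt 0 0 n w (m - 1) - 2 * fExt 0 0 n w m)

/-- `f^w_{0,0}(n)` without the indicator `1_{(y ≠ 0)}` -/
def fwetZero (E : ℝ → ℝ) (n : ℕ) : ℝ :=
  ∫ w in {w : Fin (n - 2) → ℝ | ∀ i, 0 ≤ w i},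
    ∏ m ∈ Finset.Icc (0 : ℤ) ((n : ℤ) - 1),
      E (fExt 0 0 n w (m + 1) + fExt 0 0 n w (m - 1) - 2 * fExt 0 0 n w m)

section RandomWalk

open ProbabilityTheory

/-- The joint law of `N` independent steps of law `ν`. -/
abbrev stepLaw (ν : Measure ℝ) (N : ℕ) : Measure (Fin N → ℝ) := Measure.pi fun _ => ν

variable {ν : Measure ℝ}

lemma measurable_finAppend (M N : ℕ) :
    Measurable fun p : (Fin M → ℝ) × (Fin N → ℝ) => Fin.append p.1 p.2 := by
  refine measurable_pi_lambda _ fun i => ?_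
  refine Fin.addCases (fun i => ?_) (fun i => ?_) i
  · simp only [Fin.append_left]; fun_prop
  · simp only [Fin.append_right]; fun_prop

lemma measurePreserving_finAppend [IsProbabilityMeasure ν] (M N : ℕ) :
    MeasurePreserving (fun p : (Fin M → ℝ) × (Fin N → ℝ) => Fin.append p.1 p.2)
      ((stepLaw ν M).prod (stepLaw ν N)) (stepLaw ν (M + N)) := by
  refine ⟨measurable_finAppend M N, (Measure.pi_eq fun s hs => ?_).symm⟩
  rw [Measure.map_apply (measurable_finAppend M N) (MeasurableSet.univ_pi hs)]
  have : (fun p : (Fin M → ℝ) × (Fin N → ℝ) => Fin.append p.1 p.2) ⁻¹' (univ.pi s) =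
      (univ.pi fun i => s (Fin.castAdd N i)) ×ˢ (univ.pi fun i => s (Fin.natAdd M i)) := by
    ext p
    simp only [mem_preimage, Set.mem_pi, mem_univ, true_imp_iff, mem_prod]
    constructor
    · intro h
      exact ⟨fun i => by simpa using h (Fin.castAdd N i),
        fun i => by simpa using h (Fin.natAdd M i)⟩
    · rintro ⟨h1, h2⟩ i
      refine Fin.addCases (fun i => ?_) (fun i => ?_) i
      · simpa using h1 i
      · simpa using h2 i
  rw [this, Measure.prod_prod, Measure.pi_pi, Measure.pi_pi, Fin.prod_univ_add]

lemma measurePreserving_comp_perm [IsProbabilityMeasure ν] {N : ℕ} (e : Equiv.Perm (Fin N)) :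
    MeasurePreserving (fun x : Fin N → ℝ => x ∘ e) (stepLaw ν N) (stepLaw ν N) := by
  have hm : Measurable (fun x : Fin N → ℝ => x ∘ e) :=
    measurable_pi_lambda _ fun i => measurable_pi_apply _
  refine ⟨hm, (Measure.pi_eq fun s hs => ?_).symm⟩
  rw [Measure.map_apply hm (MeasurableSet.univ_pi hs)]
  have : (fun x : Fin N → ℝ => x ∘ e) ⁻¹' (univ.pi s) = univ.pi fun i => s (e.symm i) := by
    ext p
    simp only [mem_preimage, Set.mem_pi, mem_univ, true_imp_iff, Function.comp]
    exact ⟨fun h i => by simpa using h (e.symm i), fun h i => by simpa using h (e i)⟩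
  rw [this, Measure.pi_pi]
  exact Equiv.prod_comp e.symm fun i => ν (s i)

/-- A consequence of the central limit theorem: rescaled sums charge every open interval. -/
lemma exists_pos_le_stepLaw_scaled_sum [IsProbabilityMeasure ν] {σ : ℝ} (hσ : 0 < σ)
    (hL2 : MemLp id 2 ν) (hmean : ∫ x, x ∂ν = 0) (hvar : ∫ x, x ^ 2 ∂ν = σ ^ 2)
    {a b : ℝ} (hab : a < b) :
    ∃ p : ℝ≥0∞, 0 < p ∧ ∀ᶠ N : ℕ in atTop,
      p ≤ stepLaw ν N {x | (√N)⁻¹ * ∑ i, x i ∈ Ioo a b} := by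
  let P : Measure (ℕ → ℝ) := Measure.infinitePi fun _ => ν
  let X : ℕ → (ℕ → ℝ) → ℝ := fun i ω => ω i
  have hlaw (i : ℕ) : P.map (X i) = ν := Measure.infinitePi_map_eval (fun _ => ν) i
  have hXm (i : ℕ) : Measurable (X i) := measurable_pi_apply i
  have hindep : iIndepFun X P := iIndepFun_infinitePi (X := fun _ ω => ω) (by fun_prop)
  have hident (i : ℕ) : IdentDistrib (X i) (X 0) P P :=
    ⟨(hXm i).aemeasurable, (hXm 0).aemeasurable, by rw [hlaw, hlaw]⟩
  have hX0 : MemLp (X 0) 2 P := by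
    have := hL2
    rw [← hlaw 0] at this
    exact (memLp_map_measure_iff (by fun_prop) (hXm 0).aemeasurable).1 this
  have hX0mean : ∫ ω, X 0 ω ∂P = 0 := by
    rw [← hmean, ← hlaw 0, integral_map (hXm 0).aemeasurable (by fun_prop)]
  have hX0var : Var[X 0; P] = σ ^ 2 := by
    rw [variance_of_integral_eq_zero (hXm 0).aemeasurable hX0mean, ← hvar, ← hlaw 0,
      integral_map (hXm 0).aemeasurable (by fun_prop)]
  have hclt := tendstoInDistribution_inv_sqrt_mul_sum_sub
    (Y := id) (P' := gaussianReal 0 Var[X 0; P].toNNReal) ⟨by fun_prop, by simp⟩ hX0 hindep hident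
  have hopen := ProbabilityMeasure.le_liminf_measure_open_of_tendsto hclt.tendsto
    (isOpen_Ioo (a := a) (b := b))
  have hv : Var[X 0; P].toNNReal ≠ 0 := by
    rw [hX0var]; simp [hσ.ne']
  have hgauss : 0 < gaussianReal 0 Var[X 0; P].toNNReal (Ioo a b) := by
    have h := gaussianReal_absolutelyContinuous' 0 hv
    refine pos_iff_ne_zero.2 fun h0 => ?_
    have := h h0
    simp at this
    linarith
  obtain ⟨p, hp0, hp⟩ := exists_between hgauss
  refine ⟨p, hp0, ?_⟩
  have hlt : p < liminf (fun N : ℕ => (P.map fun ω =>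
      (√N)⁻¹ * (∑ k ∈ Finset.range N, X k ω - N * ∫ ω, X 0 ω ∂P)) (Ioo a b)) atTop := by
    refine lt_of_lt_of_le hp (le_trans (le_of_eq ?_) hopen)
    simp
  have hev := eventually_lt_of_lt_liminf hlt
  filter_upwards [hev] with N hN
  refine hN.le.trans (le_of_eq ?_)
  have hmap : P.map (fun ω (i : Fin N) => ω i) = stepLaw ν N := by
    rw [Measure.map_infinitePi_infinitePi_of_inj (P := fun _ => ν) Fin.val_injective,
      Measure.infinitePi_eq_pi]
  have hmeasS : MeasurableSet {x : Fin N → ℝ | (√N)⁻¹ * ∑ i, x i ∈ Ioo a b} :=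
    measurableSet_Ioo.preimage (by fun_prop)
  rw [← hmap, Measure.map_apply (by fun_prop) hmeasS, Measure.map_apply (by fun_prop)
    measurableSet_Ioo]
  congr 1
  ext ω
  simp only [mem_preimage, mem_ofPred_eq, hX0mean, mul_zero, sub_zero, X,
    Finset.sum_range]

/-- Uniform version: with positive probability a sum of many steps brings any starting point at
diffusive distance close to the origin. -/
lemma exists_pos_le_stepLaw_abs_le [IsProbabilityMeasure ν] {σ : ℝ} (hσ : 0 < σ)
    (hL2 : MemLp id 2 ν) (hmean : ∫ x, x ∂ν = 0) (hvar : ∫ x, x ^ 2 ∂ν = σ ^ 2)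
    {κ : ℝ} (hκ : 0 < κ) :
    ∃ p : ℝ≥0∞, 0 < p ∧ ∀ᶠ N : ℕ in atTop, ∀ t : ℝ, |t| ≤ 2 * κ →
      p ≤ stepLaw ν N {x | |t + (√N)⁻¹ * ∑ i, x i| ≤ κ / 2} := by
  choose p hp0 hp using fun j : ℤ => exists_pos_le_stepLaw_scaled_sum hσ hL2 hmean hvar
    (a := κ * j / 4 - κ / 4) (b := κ * j / 4 + κ / 4) (by linarith)
  have hne : (Finset.Icc (-8 : ℤ) 8).Nonempty := ⟨0, by simp⟩
  refine ⟨(Finset.Icc (-8 : ℤ) 8).inf' hne p, ?_, ?_⟩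
  · obtain ⟨j, _, hj⟩ := Finset.exists_mem_eq_inf' hne p
    exact hj ▸ hp0 j
  · have : ∀ᶠ N : ℕ in atTop, ∀ j ∈ Finset.Icc (-8 : ℤ) 8, p j ≤ stepLaw ν N
        {x | (√N)⁻¹ * ∑ i, x i ∈ Ioo (κ * j / 4 - κ / 4) (κ * j / 4 + κ / 4)} := by
      rw [Filter.eventually_all_finset]
      exact fun j _ => hp j
    filter_upwards [this] with N hN t ht
    obtain ⟨ht1, ht2⟩ := abs_le.1 ht
    set j : ℤ := ⌊-4 * t / κ⌋ with hj
    have h1 : (j : ℝ) ≤ -4 * t / κ := Int.floor_le _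
    have h2 : -4 * t / κ < j + 1 := Int.lt_floor_add_one _
    rw [le_div_iff₀ hκ] at h1
    rw [div_lt_iff₀ hκ] at h2
    have hj1 : -8 ≤ j := by
      rw [hj, Int.le_floor, le_div_iff₀ hκ]; push_cast; linarith
    have hj2 : j ≤ 8 := by
      have : (j : ℝ) < 9 := by
        by_contra hcon
        push Not at hcon
        nlinarith
      have : j < 9 := by exact_mod_cast this
      omega
    have hjm : j ∈ Finset.Icc (-8 : ℤ) 8 := Finset.mem_Icc.2 ⟨hj1, hj2⟩
    refine (Finset.inf'_le _ hjm).trans ((hN j hjm).trans (measure_mono ?_))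
    rintro x ⟨hx1, hx2⟩
    simp only [mem_ofPred_eq]
    rw [abs_le]
    constructor <;> nlinarith

/-- Concatenation of two walks: if the first reaches `J` from `x` and the second reaches `K` from
every point of `J`, then the concatenated walk reaches `K` from `x`. -/
lemma mul_le_stepLaw_add [IsProbabilityMeasure ν] {M N : ℕ} {J K : Set ℝ}
    (hJ : MeasurableSet J) (hK : MeasurableSet K) (x : ℝ) {p q : ℝ≥0∞}
    (hp : p ≤ stepLaw ν M {ξ | x + ∑ i, ξ i ∈ J})
    (hq : ∀ y ∈ J, q ≤ stepLaw ν N {ξ | y + ∑ i, ξ i ∈ K}) :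
    p * q ≤ stepLaw ν (M + N) {ξ | x + ∑ i, ξ i ∈ K} := by
  have hmeasK : MeasurableSet {ξ : Fin (M + N) → ℝ | x + ∑ i, ξ i ∈ K} :=
    hK.preimage (by fun_prop)
  have hmeasJ : MeasurableSet {ξ : Fin M → ℝ | x + ∑ i, ξ i ∈ J} := hJ.preimage (by fun_prop)
  have hmp := measurePreserving_finAppend (ν := ν) M N
  rw [← hmp.measure_preimage hmeasK.nullMeasurableSet,
    Measure.prod_apply (hmeasK.preimage hmp.measurable)]
  calc p * q ≤ ∫⁻ _ in {ξ : Fin M → ℝ | x + ∑ i, ξ i ∈ J}, q ∂(stepLaw ν M) := by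
        rw [setLIntegral_const, mul_comm]; gcongr
    _ ≤ ∫⁻ ξ in {ξ : Fin M → ℝ | x + ∑ i, ξ i ∈ J}, stepLaw ν N
          (Prod.mk ξ ⁻¹' ((fun p : (Fin M → ℝ) × (Fin N → ℝ) => Fin.append p.1 p.2) ⁻¹'
            {ξ | x + ∑ i, ξ i ∈ K})) ∂(stepLaw ν M) := by
        refine setLIntegral_mono' hmeasJ fun ξ hξ => (hq _ hξ).trans (le_of_eq ?_)
        congr 1
        ext η
        simp [Fin.sum_univ_add, add_assoc]
    _ ≤ _ := setLIntegral_le_lintegral _ _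

/-- Small steps connect any starting point at distance at most `δ / 2 * √N` to `[0, δ]`. -/
lemma pow_le_stepLaw_mem_Icc [IsProbabilityMeasure ν] {δ ε : ℝ} (hδ : 0 < δ)
    (hdens : ∀ a b, -δ ≤ a → a ≤ b → b ≤ δ → ENNReal.ofReal (ε * (b - a)) ≤ ν (Icc a b))
    (N : ℕ) (x : ℝ) (hx : |x| ≤ δ / 2 * √N) :
    ENNReal.ofReal (ε * (δ / (2 * N))) ^ N ≤ stepLaw ν N {ξ | x + ∑ i, ξ i ∈ Icc 0 δ} := by
  rcases Nat.eq_zero_or_pos N with rfl | hN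
  · have hx0 : x = 0 := by simpa using hx
    simp [hx0, hδ.le]
  have hN1 : (1 : ℝ) ≤ N := by exact_mod_cast hN
  have hN0 : (0 : ℝ) < N := by linarith
  have hsqrt : √(N : ℝ) ≤ N := by
    rw [Real.sqrt_le_left hN0.le]; nlinarith
  have hx' : |x| ≤ δ / 2 * N := hx.trans (by gcongr)
  obtain ⟨hx1, hx2⟩ := abs_le.1 hx'
  have hb1 : -(δ / 2) ≤ -x / N := by rw [le_div_iff₀ hN0]; linarith
  have hb2 : -x / N ≤ δ / 2 := by rw [div_le_iff₀ hN0]; linarith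
  have hd : δ / (2 * N) ≤ δ / 2 := by
    gcongr; linarith
  have hd0 : 0 < δ / (2 * N) := by positivity
  have hbox : (univ.pi fun _ : Fin N => Icc (-x / N) (-x / N + δ / (2 * N))) ⊆
      {ξ | x + ∑ i, ξ i ∈ Icc 0 δ} := by
    intro ξ hξ
    simp only [Set.mem_pi, mem_univ, true_imp_iff] at hξ
    have h1 : ∑ _i : Fin N, (-x / N) ≤ ∑ i, ξ i := Finset.sum_le_sum fun i _ => (hξ i).1
    have h2 : ∑ i, ξ i ≤ ∑ _i : Fin N, (-x / N + δ / (2 * N)) :=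
      Finset.sum_le_sum fun i _ => (hξ i).2
    simp only [Finset.sum_const, Finset.card_univ, Fintype.card_fin, nsmul_eq_mul] at h1 h2
    have e1 : (N : ℝ) * (-x / N) = -x := by field_simp
    have e2 : (N : ℝ) * (-x / N + δ / (2 * N)) = -x + δ / 2 := by field_simp
    rw [e1] at h1
    rw [e2] at h2
    exact ⟨by linarith, by linarith⟩
  refine le_trans ?_ (measure_mono hbox)
  rw [Measure.pi_pi, Finset.prod_const, Finset.card_univ, Fintype.card_fin]
  gcongr
  convert! hdens (-x / N) (-x / N + δ / (2 * N)) (by linarith) (by linarith) (by linarith) using 3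
  ring

/-- A polynomial lower bound for the probability that the walk sits in the window `[0, δ]`. -/
lemma exists_poly_le_stepLaw_mem_Icc [IsProbabilityMeasure ν] {σ : ℝ} (hσ : 0 < σ)
    (hL2 : MemLp id 2 ν) (hmean : ∫ x, x ∂ν = 0) (hvar : ∫ x, x ^ 2 ∂ν = σ ^ 2)
    {δ ε : ℝ} (hδ : 0 < δ) (hε : 0 < ε)
    (hdens : ∀ a b, -δ ≤ a → a ≤ b → b ≤ δ → ENNReal.ofReal (ε * (b - a)) ≤ ν (Icc a b)) :
    ∃ c : ℝ, 0 < c ∧ ∃ C : ℕ, ∀ N : ℕ, ∀ x : ℝ, |x| ≤ δ / 2 * √N →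
      ENNReal.ofReal (c / (N + 1) ^ C) ≤ stepLaw ν N {ξ | x + ∑ i, ξ i ∈ Icc 0 δ} := by
  have hκ : 0 < δ / 2 := by linarith
  obtain ⟨p, hp0, hp⟩ := exists_pos_le_stepLaw_abs_le hσ hL2 hmean hvar hκ
  obtain ⟨N₀, hN₀⟩ := eventually_atTop.1 hp
  have hstep (M N : ℕ) (hM : N₀ ≤ M) (hN : 1 ≤ N) (h1 : N ≤ M) (h2 : M ≤ N + 1) (x : ℝ)
      (hx : |x| ≤ δ / 2 * √(M + N : ℕ)) :
      p ≤ stepLaw ν M {ξ | x + ∑ i, ξ i ∈ Icc (-(δ / 2 * √N)) (δ / 2 * √N)} := by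
    have hM0 : (0 : ℝ) < M := by exact_mod_cast (by omega : 0 < M)
    have hsM : 0 < √(M : ℝ) := Real.sqrt_pos.2 hM0
    have hs1 : √((M + N : ℕ) : ℝ) ≤ 2 * √M := by
      rw [Real.sqrt_le_left (by positivity), mul_pow, Real.sq_sqrt hM0.le]
      push_cast
      have : (N : ℝ) ≤ M := by exact_mod_cast h1
      linarith
    have hs2 : √(M : ℝ) ≤ 2 * √N := by
      rw [Real.sqrt_le_left (by positivity), mul_pow, Real.sq_sqrt (by positivity)]
      have : (M : ℝ) ≤ N + 1 := by exact_mod_cast h2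
      have : (1 : ℝ) ≤ N := by exact_mod_cast hN
      linarith
    have ht : |x / √M| ≤ 2 * (δ / 2) := by
      rw [abs_div, abs_of_pos hsM, div_le_iff₀ hsM]
      nlinarith
    refine (hN₀ M hM _ ht).trans (measure_mono fun ξ hξ => ?_)
    simp only [mem_ofPred_eq] at hξ ⊢
    rw [mem_Icc, ← abs_le]
    have : x + ∑ i, ξ i = √M * (x / √M + (√M)⁻¹ * ∑ i, ξ i) := by field_simp
    rw [this, abs_mul, abs_of_pos hsM]
    nlinarith
  set r : ℝ := (min p 1).toReal with hr
  have hmin : min p 1 ≠ ∞ := ne_top_of_le_ne_top ENNReal.one_ne_top (min_le_right _ _)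
  have hr0 : 0 < r := ENNReal.toReal_pos (lt_min hp0 one_pos).ne' hmin
  have hrp : ENNReal.ofReal r ≤ p := by
    rw [hr, ENNReal.ofReal_toReal hmin]; exact min_le_left _ _
  obtain ⟨C, hC⟩ := exists_pow_lt_of_lt_one hr0 (by norm_num : (3 / 4 : ℝ) < 1)
  let q : ℕ → ℝ := fun N => (ε * (δ / (2 * N))) ^ N
  have hq0 (N : ℕ) : 0 < q N := by
    rcases Nat.eq_zero_or_pos N with rfl | hN
    · simp [q]
    · have : (0 : ℝ) < N := by exact_mod_cast hN
      positivity
  set B := 2 * N₀ + 2 with hB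
  have hne : (Finset.range B).Nonempty := ⟨0, by simp [hB]⟩
  obtain ⟨k, -, hk⟩ := Finset.exists_mem_eq_inf' hne q
  refine ⟨q k, hq0 k, C, fun N => ?_⟩
  induction N using Nat.strong_induction_on with
  | _ N ih =>
    intro x hx
    by_cases hNB : N < B
    · refine le_trans ?_ (pow_le_stepLaw_mem_Icc hδ hdens N x hx)
      rw [← ENNReal.ofReal_pow (by positivity)]
      refine ENNReal.ofReal_le_ofReal ?_
      have h1 : q k ≤ q N := hk ▸ Finset.inf'_le q (Finset.mem_range.2 hNB)
      refine le_trans (div_le_self (hq0 k).le ?_) h1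
      exact one_le_pow₀ (by linarith [Nat.cast_nonneg (α := ℝ) N])
    · push Not at hNB
      obtain ⟨M, N', rfl, h1, h2⟩ : ∃ M N', N = M + N' ∧ N' ≤ M ∧ M ≤ N' + 1 :=
        ⟨N - N / 2, N / 2, by omega, by omega, by omega⟩
      have h3 := mul_le_stepLaw_add measurableSet_Icc measurableSet_Icc x
        (hstep M N' (by omega) (by omega) h1 h2 x hx)
        (fun y hy => ih N' (by omega) y (abs_le.2 hy))
      refine le_trans ?_ h3
      refine le_trans ?_ (mul_le_mul_left hrp _)
      rw [← ENNReal.ofReal_mul hr0.le]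
      refine ENNReal.ofReal_le_ofReal ?_
      have hN'1 : (1 : ℝ) ≤ N' := by exact_mod_cast (by omega : 1 ≤ N')
      have hMN : (N' : ℝ) ≤ M := by exact_mod_cast h1
      have hratio : (3 / 4 : ℝ) ^ C * (((M + N' : ℕ) : ℝ) + 1) ^ C ≥ ((N' : ℝ) + 1) ^ C := by
        rw [← mul_pow]
        gcongr
        push_cast
        linarith
      rw [div_le_iff₀ (by positivity), mul_div_assoc', div_mul_eq_mul_div,
        le_div_iff₀ (by positivity)]
      have : ((N' : ℝ) + 1) ^ C ≤ r * (((M + N' : ℕ) : ℝ) + 1) ^ C :=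
        hratio.le.trans (by gcongr)
      calc q k * ((N' : ℝ) + 1) ^ C ≤ q k * (r * (((M + N' : ℕ) : ℝ) + 1) ^ C) := by
            have := (hq0 k).le
            gcongr
        _ = _ := by ring

/-- The `j`-th step of a walk with `N` steps, extended by zero. -/
def stepAt {N : ℕ} (ξ : Fin N → ℝ) (j : ℕ) : ℝ := if h : j < N then ξ ⟨j, h⟩ else 0

/-- The walk with steps `ξ`. -/
def walk {N : ℕ} (ξ : Fin N → ℝ) (k : ℕ) : ℝ := ∑ j ∈ Finset.range k, stepAt ξ j

/-- The integrated walk with steps `ξ`. -/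
def integratedWalk {N : ℕ} (ξ : Fin N → ℝ) (k : ℕ) : ℝ := ∑ j ∈ Finset.range k, walk ξ (j + 1)

@[fun_prop]
lemma measurable_stepAt (N j : ℕ) : Measurable fun ξ : Fin N → ℝ => stepAt ξ j := by
  unfold stepAt
  split_ifs <;> fun_prop

@[fun_prop]
lemma measurable_walk (N k : ℕ) : Measurable fun ξ : Fin N → ℝ => walk ξ k := by
  unfold walk; fun_prop

@[fun_prop]
lemma measurable_integratedWalk (N k : ℕ) :
    Measurable fun ξ : Fin N → ℝ => integratedWalk ξ k := by
  unfold integratedWalk; fun_prop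

lemma walk_succ {N : ℕ} (ξ : Fin N → ℝ) (k : ℕ) : walk ξ (k + 1) = walk ξ k + stepAt ξ k :=
  Finset.sum_range_succ _ _

lemma integratedWalk_succ {N : ℕ} (ξ : Fin N → ℝ) (k : ℕ) :
    integratedWalk ξ (k + 1) = integratedWalk ξ k + walk ξ (k + 1) :=
  Finset.sum_range_succ _ _

/-- The steps for which the walk stays nonnegative and ends in `[0, δ]`. -/
def excursionSet (N : ℕ) (δ : ℝ) : Set (Fin N → ℝ) :=
  {ξ | (∀ k ≤ N, 0 ≤ walk ξ k) ∧ walk ξ N ≤ δ}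

lemma measurableSet_excursionSet (N : ℕ) (δ : ℝ) : MeasurableSet (excursionSet N δ) := by
  have : excursionSet N δ =
      (⋂ k ∈ Finset.range (N + 1), {ξ : Fin N → ℝ | 0 ≤ walk ξ k}) ∩ {ξ | walk ξ N ≤ δ} := by
    ext ξ
    simp [excursionSet]
  rw [this]
  refine (Finset.measurableSet_biInter _ fun k _ => ?_).inter ?_
  · exact measurableSet_le measurable_const (by fun_prop)
  · exact measurableSet_le (by fun_prop) measurable_const

/-- Some rotation of a cyclic sequence with nonnegative sum has nonnegative partial sums. -/
lemma exists_rotate_mem_excursionSet {N : ℕ} [NeZero N] {δ : ℝ} {ξ : Fin N → ℝ}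
    (h0 : 0 ≤ ∑ i, ξ i) (hδ : ∑ i, ξ i ≤ δ) :
    ∃ r : Fin N, ξ ∘ Equiv.addRight r ∈ excursionSet N δ := by
  have hN : 0 < N := Nat.pos_of_ne_zero (NeZero.ne N)
  let per : ℕ → ℝ := fun j => ξ ⟨j % N, Nat.mod_lt _ hN⟩
  let P : ℕ → ℝ := fun k => ∑ j ∈ Finset.range k, per j
  have hPN (k : ℕ) : P (k + N) = P k + ∑ i, ξ i := by
    induction k with
    | zero =>
      have hP0 : P 0 = 0 := Finset.sum_range_zero _
      rw [hP0, zero_add, zero_add]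
      simp only [P, Finset.sum_range]
      refine Finset.sum_congr rfl fun i _ => ?_
      simp [per, Nat.mod_eq_of_lt i.2]
    | succ k ih =>
      have e : k + 1 + N = k + N + 1 := by ring
      have e1 : P (k + N + 1) = P (k + N) + per (k + N) := Finset.sum_range_succ _ _
      have e2 : P (k + 1) = P k + per k := Finset.sum_range_succ _ _
      have e3 : per (k + N) = per k := by simp [per]
      rw [e, e1, e2, e3, ih]; ring
  obtain ⟨r, hr, hmin⟩ := Finset.exists_min_image (Finset.range N) P ⟨0, by simpa using hN⟩
  rw [Finset.mem_range] at hr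
  let r' : Fin N := ⟨r, hr⟩
  have hwalk (k : ℕ) (hk : k ≤ N) : walk (ξ ∘ Equiv.addRight r') k = P (r + k) - P r := by
    simp only [P, Finset.sum_range_add, walk, add_sub_cancel_left]
    refine Finset.sum_congr rfl fun j hj => ?_
    have hj' : j < N := (Finset.mem_range.1 hj).trans_le hk
    simp only [stepAt, hj', dite_true, Function.comp, Equiv.coe_addRight, per]
    congr 1
    ext
    simp [Fin.val_add, r', add_comm]
  refine ⟨r', fun k hk => ?_, ?_⟩
  · rw [hwalk k hk, sub_nonneg]
    by_cases h : r + k < N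
    · exact hmin _ (Finset.mem_range.2 h)
    · obtain ⟨l, hl⟩ : ∃ l, r + k = l + N := ⟨r + k - N, by omega⟩
      rw [hl, hPN]
      have := hmin l (Finset.mem_range.2 (by omega))
      linarith
  · rw [hwalk N le_rfl, hPN]; linarith

lemma stepLaw_sum_mem_Icc_le [IsProbabilityMeasure ν] (N : ℕ) (δ : ℝ) :
    stepLaw ν N {ξ | ∑ i, ξ i ∈ Icc 0 δ} ≤ (N + 1 : ℝ≥0∞) * stepLaw ν N (excursionSet N δ) := by
  rcases Nat.eq_zero_or_pos N with rfl | hN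
  · simp only [Nat.cast_zero, zero_add, one_mul]
    refine measure_mono fun ξ hξ => ⟨fun k hk => ?_, ?_⟩
    · obtain rfl : k = 0 := by omega
      simp [walk]
    · simpa [walk] using hξ.2
  have : NeZero N := ⟨hN.ne'⟩
  calc stepLaw ν N {ξ | ∑ i, ξ i ∈ Icc 0 δ}
      ≤ stepLaw ν N (⋃ r : Fin N, (fun ξ : Fin N → ℝ => ξ ∘ Equiv.addRight r) ⁻¹'
          excursionSet N δ) := by
        refine measure_mono fun ξ hξ => ?_
        obtain ⟨r, hr⟩ := exists_rotate_mem_excursionSet hξ.1 hξ.2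
        exact mem_iUnion.2 ⟨r, hr⟩
    _ ≤ ∑ r : Fin N, stepLaw ν N ((fun ξ : Fin N → ℝ => ξ ∘ Equiv.addRight r) ⁻¹'
          excursionSet N δ) := measure_iUnion_fintype_le _ _
    _ = N * stepLaw ν N (excursionSet N δ) := by
        rw [Finset.sum_congr rfl fun r _ => (measurePreserving_comp_perm (ν := ν)
          (Equiv.addRight r)).measure_preimage (measurableSet_excursionSet N δ).nullMeasurableSet]
        simp
    _ ≤ _ := by gcongr; exact le_self_add

lemma walk_append_of_le {M N : ℕ} (ξ : Fin M → ℝ) (η : Fin N → ℝ) {k : ℕ} (hk : k ≤ M) :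
    walk (Fin.append ξ η) k = walk ξ k := by
  refine Finset.sum_congr rfl fun j hj => ?_
  have hj : j < M := (Finset.mem_range.1 hj).trans_le hk
  have e : (⟨j, hj.trans_le (Nat.le_add_right M N)⟩ : Fin (M + N)) = Fin.castAdd N ⟨j, hj⟩ := rfl
  simp only [stepAt, hj, hj.trans_le (Nat.le_add_right M N), dite_true]
  rw [e, Fin.append_left]

lemma integratedWalk_append_of_le {M N : ℕ} (ξ : Fin M → ℝ) (η : Fin N → ℝ) {k : ℕ} (hk : k ≤ M) :
    integratedWalk (Fin.append ξ η) k = integratedWalk ξ k :=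
  Finset.sum_congr rfl fun j hj =>
    walk_append_of_le ξ η (by have := Finset.mem_range.1 hj; omega)

lemma stepLaw_exists_le_abs_le [IsProbabilityMeasure ν] (N : ℕ) {T : ℝ} (hT : 0 < T) :
    stepLaw ν N {ξ | ∃ i, T ≤ |ξ i|} ≤ N * ((∫⁻ x, ‖x‖ₑ ∂ν) / ENNReal.ofReal T) := by
  have hone : ν {x | T ≤ |x|} ≤ (∫⁻ x, ‖x‖ₑ ∂ν) / ENNReal.ofReal T := by
    refine le_trans (measure_mono fun x hx => ?_)
      (meas_ge_le_lintegral_div (by fun_prop) (by simpa using hT) ENNReal.ofReal_ne_top)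
    rw [mem_ofPred_eq, Real.enorm_eq_ofReal_abs]
    exact ENNReal.ofReal_le_ofReal hx
  have hmeas : MeasurableSet {x : ℝ | T ≤ |x|} := measurableSet_le measurable_const (by fun_prop)
  calc stepLaw ν N {ξ | ∃ i, T ≤ |ξ i|}
      = stepLaw ν N (⋃ i : Fin N, (fun ξ : Fin N → ℝ => ξ i) ⁻¹' {x | T ≤ |x|}) := by
        congr 1; ext ξ; simp
    _ ≤ ∑ i : Fin N, stepLaw ν N ((fun ξ : Fin N → ℝ => ξ i) ⁻¹' {x | T ≤ |x|}) :=
        measure_iUnion_fintype_le _ _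
    _ = ∑ i : Fin N, ν {x | T ≤ |x|} := Finset.sum_congr rfl fun i _ =>
        (measurePreserving_eval (fun _ : Fin N => ν) i).measure_preimage hmeas.nullMeasurableSet
    _ ≤ _ := by
        simp only [Finset.sum_const, Finset.card_univ, Fintype.card_fin, nsmul_eq_mul]
        gcongr

lemma integratedWalk_le_of_abs_le {N : ℕ} {ξ : Fin N → ℝ} {T : ℝ} (hT : 0 ≤ T)
    (h : ∀ i, |ξ i| ≤ T) : integratedWalk ξ N ≤ N * (N * T) := by
  have hstep (j : ℕ) : stepAt ξ j ≤ T := by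
    unfold stepAt
    split_ifs
    · exact (le_abs_self _).trans (h _)
    · exact hT
  have hwalk (k : ℕ) (hk : k ≤ N) : walk ξ k ≤ N * T := by
    calc walk ξ k ≤ ∑ _j ∈ Finset.range k, T := Finset.sum_le_sum fun j _ => hstep j
      _ = k * T := by simp
      _ ≤ N * T := by gcongr
  calc integratedWalk ξ N ≤ ∑ _j ∈ Finset.range N, (N * T : ℝ) :=
        Finset.sum_le_sum fun j hj => hwalk _ (Finset.mem_range.1 hj)
    _ = _ := by simp

lemma integratedWalk_nonneg {N : ℕ} {ξ : Fin N → ℝ} (h : ∀ k ≤ N, 0 ≤ walk ξ k) {k : ℕ}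
    (hk : k ≤ N) : 0 ≤ integratedWalk ξ k :=
  Finset.sum_nonneg fun j hj => h _ (by have := Finset.mem_range.1 hj; omega)

/-- The excursions of length `N` whose integral lies in `[z, z + δ]`. -/
def excursionBin (N : ℕ) (δ z : ℝ) : Set (Fin N → ℝ) :=
  excursionSet N δ ∩ {ξ | integratedWalk ξ N ∈ Icc z (z + δ)}

/-- For some `z` the excursions whose integral lies in `[z, z + δ]` have polynomially large
probability. -/
lemma exists_poly_le_stepLaw_excursionBin [IsProbabilityMeasure ν] {σ : ℝ} (hσ : 0 < σ)
    (hL2 : MemLp id 2 ν) (hmean : ∫ x, x ∂ν = 0) (hvar : ∫ x, x ^ 2 ∂ν = σ ^ 2)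
    {δ ε : ℝ} (hδ : 0 < δ) (hε : 0 < ε)
    (hdens : ∀ a b, -δ ≤ a → a ≤ b → b ≤ δ → ENNReal.ofReal (ε * (b - a)) ≤ ν (Icc a b)) :
    ∃ c : ℝ, 0 < c ∧ ∃ C : ℕ, ∀ N : ℕ, ∃ z : ℝ,
      ENNReal.ofReal (c / (N + 1) ^ C) ≤ stepLaw ν N (excursionBin N δ z) := by
  obtain ⟨c₀, hc₀, C₀, hwin⟩ := exists_poly_le_stepLaw_mem_Icc hσ hL2 hmean hvar hδ hε hdens
  have hid_int : Integrable (id : ℝ → ℝ) ν := hL2.integrable (by norm_num)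
  have hmfin : ∫⁻ x, ‖x‖ₑ ∂ν ≠ ∞ := hid_int.hasFiniteIntegral.ne
  set m : ℝ := (∫⁻ x, ‖x‖ₑ ∂ν).toReal with hm
  have hm0 : 0 ≤ m := ENNReal.toReal_nonneg
  obtain ⟨A, hA⟩ := exists_nat_gt (2 * m / c₀)
  obtain ⟨B, hB⟩ := exists_nat_gt (A / δ)
  have hA0 : (0 : ℝ) < A := lt_of_le_of_lt (by positivity) hA
  have hB0 : (0 : ℝ) < B := lt_of_le_of_lt (by positivity) hB
  rw [div_lt_iff₀ hc₀] at hA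
  rw [div_lt_iff₀ hδ] at hB
  refine ⟨c₀ / (2 * B), by positivity, 2 * C₀ + 5, fun N => ?_⟩
  set L : ℝ := (N : ℝ) + 1 with hL
  have hL1 : 1 ≤ L := by simp [hL]
  have hNL : (N : ℝ) ≤ L := by simp [hL]
  have hN0 : (0 : ℝ) ≤ N := Nat.cast_nonneg N
  set T : ℝ := A * L ^ (C₀ + 2) with hTdef
  have hT0 : 0 < T := by positivity
  set H : ℝ := c₀ / L ^ (C₀ + 1) with hHdef
  have hH0 : 0 < H := by positivity
  have hG : ENNReal.ofReal H ≤ stepLaw ν N (excursionSet N δ) := by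
    have h1 := (hwin N 0 (by simp; positivity)).trans
      ((measure_mono (by simp)).trans (stepLaw_sum_mem_Icc_le N δ))
    have hLe : ((N : ℝ≥0∞) + 1) = ENNReal.ofReal L := by
      rw [hL, ENNReal.ofReal_add hN0 zero_le_one]; simp
    have hLH : c₀ / L ^ C₀ = L * H := by
      rw [hHdef]; field_simp; ring
    rw [hLe, hLH, ENNReal.ofReal_mul (by linarith)] at h1
    exact (ENNReal.mul_le_mul_iff_right (by simp; linarith) ENNReal.ofReal_ne_top).1 h1
  have hbad : stepLaw ν N {ξ | ∃ i, T ≤ |ξ i|} ≤ ENNReal.ofReal (H / 2) := by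
    refine (stepLaw_exists_le_abs_le N hT0).trans ?_
    rw [← ENNReal.ofReal_toReal hmfin, ← hm, ← ENNReal.ofReal_div_of_pos hT0,
      ← ENNReal.ofReal_natCast, ← ENNReal.ofReal_mul hN0]
    refine ENNReal.ofReal_le_ofReal ?_
    rw [hHdef, hTdef, mul_div_assoc', div_div, div_le_div_iff₀ (by positivity) (by positivity)]
    calc N * m * (L ^ (C₀ + 1) * 2) ≤ L * m * (L ^ (C₀ + 1) * 2) := by gcongr
      _ = (2 * m) * L ^ (C₀ + 2) := by ring
      _ ≤ (A * c₀) * L ^ (C₀ + 2) := by gcongr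
      _ = _ := by ring
  set K : ℕ := B * (N + 1) ^ (C₀ + 4) with hKdef
  have hKreal : (K : ℝ) = B * L ^ (C₀ + 4) := by simp [hKdef, hL]
  have hcover : excursionSet N δ ⊆ (⋃ j ∈ Finset.range K, excursionBin N δ (j * δ)) ∪
      {ξ | ∃ i, T ≤ |ξ i|} := by
    intro ξ hξ
    by_cases hbadξ : ∃ i, T ≤ |ξ i|
    · exact Or.inr hbadξ
    · left
      push Not at hbadξ
      have hZ0 := integratedWalk_nonneg hξ.1 le_rfl
      have hZ := integratedWalk_le_of_abs_le hT0.le fun i => (hbadξ i).le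
      have hZ' : integratedWalk ξ N < K * δ := by
        calc integratedWalk ξ N ≤ N * (N * T) := hZ
          _ ≤ L * (L * T) := by gcongr
          _ = A * L ^ (C₀ + 4) := by rw [hTdef]; ring
          _ < B * δ * L ^ (C₀ + 4) := by gcongr
          _ = K * δ := by rw [hKreal]; ring
      have hfl := Nat.floor_le (div_nonneg hZ0 hδ.le)
      have hlt := Nat.lt_floor_add_one (integratedWalk ξ N / δ)
      rw [le_div_iff₀ hδ] at hfl
      rw [div_lt_iff₀ hδ] at hlt
      refine mem_iUnion₂.2 ⟨⌊integratedWalk ξ N / δ⌋₊, ?_, hξ, hfl, by linarith⟩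
      rw [Finset.mem_range, Nat.floor_lt (div_nonneg hZ0 hδ.le), div_lt_iff₀ hδ]
      exact hZ'
  by_contra! hcon
  have hLK : 0 < K := by
    have : (0 : ℝ) < K := by rw [hKreal]; positivity
    exact_mod_cast this
  have hsum : ∑ j ∈ Finset.range K, stepLaw ν N (excursionBin N δ (j * δ)) <
      ENNReal.ofReal (H / 2) := by
    refine (ENNReal.sum_lt_sum_of_nonempty ⟨0, by simpa using hLK⟩
      fun (j : ℕ) _ => hcon (j * δ)).trans_eq ?_
    rw [Finset.sum_const, Finset.card_range, nsmul_eq_mul, ← ENNReal.ofReal_natCast,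
      ← ENNReal.ofReal_mul (Nat.cast_nonneg K), hKreal, hHdef]
    congr 1
    field_simp
    ring
  have htotal : ENNReal.ofReal H < ENNReal.ofReal H := by
    calc ENNReal.ofReal H ≤ stepLaw ν N (excursionSet N δ) := hG
      _ ≤ stepLaw ν N (⋃ j ∈ Finset.range K, excursionBin N δ (j * δ)) +
          stepLaw ν N {ξ | ∃ i, T ≤ |ξ i|} := (measure_mono hcover).trans (measure_union_le _ _)
      _ ≤ ∑ j ∈ Finset.range K, stepLaw ν N (excursionBin N δ (j * δ)) +
          ENNReal.ofReal (H / 2) := by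
          gcongr
          exact measure_biUnion_finset_le _ _
      _ < ENNReal.ofReal (H / 2) + ENNReal.ofReal (H / 2) :=
          ENNReal.add_lt_add_of_lt_of_le ENNReal.ofReal_ne_top hsum le_rfl
      _ = ENNReal.ofReal H := by
          rw [← ENNReal.ofReal_add (by positivity) (by positivity)]; congr 1; ring
  exact lt_irrefl _ htotal

/-- The steps for which the walk stays nonnegative, ends in `[0, 2δ]`, and has its integral in
`[z, z + 3δ]`. -/
def halfPathSet (N : ℕ) (δ z : ℝ) : Set (Fin N → ℝ) :=
  {ξ | (∀ k ≤ N, 0 ≤ walk ξ k) ∧ walk ξ N ≤ 2 * δ ∧ integratedWalk ξ N ∈ Icc z (z + 3 * δ)}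

lemma excursionBin_subset_halfPathSet {N : ℕ} {δ z : ℝ} (hδ : 0 ≤ δ) :
    excursionBin N δ z ⊆ halfPathSet N δ z := fun _ hξ =>
  ⟨hξ.1.1, hξ.1.2.trans (by linarith), hξ.2.1, hξ.2.2.trans (by linarith)⟩

lemma measurableSet_halfPathSet (N : ℕ) (δ z : ℝ) : MeasurableSet (halfPathSet N δ z) := by
  have : halfPathSet N δ z = excursionSet N (2 * δ) ∩
      {ξ | integratedWalk ξ N ∈ Icc z (z + 3 * δ)} := by
    ext ξ
    simp [halfPathSet, excursionSet, and_assoc]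
  rw [this]
  exact (measurableSet_excursionSet _ _).inter (measurableSet_Icc.preimage (by fun_prop))

lemma mul_le_stepLaw_succ_halfPathSet [IsProbabilityMeasure ν] (N : ℕ) (δ z : ℝ) :
    stepLaw ν N (excursionBin N δ z) * ν (Icc 0 δ) ≤
      stepLaw ν (N + 1) (halfPathSet (N + 1) δ z) := by
  have hmp := measurePreserving_finAppend (ν := ν) N 1
  rw [← hmp.measure_preimage (measurableSet_halfPathSet _ _ _).nullMeasurableSet]
  have hone : ν (Icc 0 δ) = stepLaw ν 1 (univ.pi fun _ => Icc 0 δ) := by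
    rw [Measure.pi_pi]; simp
  rw [hone, ← Measure.prod_prod]
  refine measure_mono ?_
  rintro ⟨ξ, η⟩ ⟨⟨⟨hξ, hξδ⟩, hz1, hz2⟩, hη⟩
  have hη0 : η 0 ∈ Icc 0 δ := hη 0 (mem_univ _)
  have hlast : stepAt (Fin.append ξ η) N = η 0 := by
    have e : (⟨N, Nat.lt_succ_self N⟩ : Fin (N + 1)) = Fin.natAdd N (0 : Fin 1) := rfl
    simp only [stepAt, Nat.lt_succ_self, dite_true]
    rw [e, Fin.append_right]
  have hw : walk (Fin.append ξ η) (N + 1) = walk ξ N + η 0 := by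
    rw [walk_succ, hlast, walk_append_of_le _ _ le_rfl]
  have hi : integratedWalk (Fin.append ξ η) (N + 1) = integratedWalk ξ N + (walk ξ N + η 0) := by
    rw [integratedWalk_succ, hw, integratedWalk_append_of_le _ _ le_rfl]
  have hN := hξ N le_rfl
  refine ⟨fun k hk => ?_, ?_, ?_, ?_⟩
  · rcases Nat.lt_or_ge N k with h | h
    · obtain rfl : k = N + 1 := by omega
      rw [hw]; linarith [hη0.1]
    · rw [walk_append_of_le _ _ h]; exact hξ k h
  · rw [hw]; linarith [hη0.2]
  · rw [hi]; linarith [hη0.1]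
  · rw [hi]; linarith [hη0.2]

lemma measurableSet_glue {M N : ℕ} {A : Set (Fin M → ℝ)} {B : Set (Fin N → ℝ)}
    (hA : MeasurableSet A) (hB : MeasurableSet B) :
    MeasurableSet {x : Fin (M + N) → ℝ |
      x ∘ Fin.castAdd N ∈ A ∧ x ∘ Fin.natAdd M ∘ Fin.rev ∈ B} := by
  refine (hA.preimage ?_).inter (hB.preimage ?_)
  all_goals exact measurable_pi_lambda _ fun i => measurable_pi_apply _

/-- Two independent half paths glued back to back. -/
lemma mul_le_stepLaw_glue [IsProbabilityMeasure ν] {M N : ℕ} {A : Set (Fin M → ℝ)}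
    {B : Set (Fin N → ℝ)} (hA : MeasurableSet A) (hB : MeasurableSet B) :
    stepLaw ν M A * stepLaw ν N B ≤ stepLaw ν (M + N)
      {x | x ∘ Fin.castAdd N ∈ A ∧ x ∘ Fin.natAdd M ∘ Fin.rev ∈ B} := by
  have hmp := measurePreserving_finAppend (ν := ν) M N
  have hrev := measurePreserving_comp_perm (ν := ν) (N := N) Fin.revPerm
  rw [← hmp.measure_preimage (measurableSet_glue hA hB).nullMeasurableSet,
    ← hrev.measure_preimage hB.nullMeasurableSet, ← Measure.prod_prod]
  refine measure_mono ?_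
  rintro ⟨ξ, η⟩ ⟨hξ, hη⟩
  refine ⟨?_, ?_⟩
  · convert! hξ using 1
    ext i
    simp
  · have hη' : η ∘ Fin.revPerm ∈ B := hη
    convert! hη' using 1
    ext i
    simp

/-- Two independent half paths of lengths `M` and `N`, with `N ∈ {M, M + 1}`, meet at the same
height with polynomially large probability. -/
lemma exists_poly_le_stepLaw_glue_halfPathSet [IsProbabilityMeasure ν] {σ : ℝ} (hσ : 0 < σ)
    (hL2 : MemLp id 2 ν) (hmean : ∫ x, x ∂ν = 0) (hvar : ∫ x, x ^ 2 ∂ν = σ ^ 2)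
    {δ ε : ℝ} (hδ : 0 < δ) (hε : 0 < ε)
    (hdens : ∀ a b, -δ ≤ a → a ≤ b → b ≤ δ → ENNReal.ofReal (ε * (b - a)) ≤ ν (Icc a b)) :
    ∃ c : ℝ, 0 < c ∧ ∃ C : ℕ, ∀ M N : ℕ, M ≤ N → N ≤ M + 1 → ∃ z : ℝ,
      ENNReal.ofReal (c / (M + 1) ^ C) ≤ stepLaw ν (M + N)
        {x | x ∘ Fin.castAdd N ∈ halfPathSet M δ z ∧
          x ∘ Fin.natAdd M ∘ Fin.rev ∈ halfPathSet N δ z} := by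
  obtain ⟨c, hc, C, h⟩ := exists_poly_le_stepLaw_excursionBin hσ hL2 hmean hvar hδ hε hdens
  set s : ℝ := min 1 (ε * δ) with hs
  have hs0 : 0 < s := lt_min one_pos (by positivity)
  have hsν : ENNReal.ofReal s ≤ ν (Icc 0 δ) := by
    refine le_trans (ENNReal.ofReal_le_ofReal (min_le_right _ _)) ?_
    simpa using hdens 0 δ (by linarith) hδ.le le_rfl
  refine ⟨c * (c * s), by positivity, C + C, fun M N hMN hNM => ?_⟩
  obtain ⟨z, hz⟩ := h M
  refine ⟨z, le_trans ?_ (mul_le_stepLaw_glue (measurableSet_halfPathSet _ _ _)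
    (measurableSet_halfPathSet _ _ _))⟩
  have hL : (0 : ℝ) < M + 1 := by positivity
  have e : c * (c * s) / ((M : ℝ) + 1) ^ (C + C) =
      c / (M + 1) ^ C * (c / (M + 1) ^ C * s) := by
    rw [pow_add]; field_simp
  rw [e, ENNReal.ofReal_mul (by positivity), ENNReal.ofReal_mul (by positivity)]
  refine mul_le_mul' (hz.trans (measure_mono (excursionBin_subset_halfPathSet hδ.le))) ?_
  rcases hMN.eq_or_lt with rfl | hlt
  · calc _ ≤ ENNReal.ofReal (c / (M + 1) ^ C) * 1 := by
          gcongr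
          exact ENNReal.ofReal_le_one.2 (min_le_left _ _)
      _ ≤ _ := by
          rw [mul_one]
          exact hz.trans (measure_mono (excursionBin_subset_halfPathSet hδ.le))
  · obtain rfl : N = M + 1 := by omega
    exact (mul_le_mul' hz hsν).trans (mul_le_stepLaw_succ_halfPathSet M δ z)

end RandomWalk

section Laplacian

/-- A matrix that is unitriangular with respect to an injective ranking of its indices has
determinant one. -/
lemma det_eq_one_of_blockTriangular_injective {m α : Type*} [Fintype m] [DecidableEq m]
    [LinearOrder α] {A : Matrix m m ℝ} {b : m → α} (hA : A.BlockTriangular b)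
    (hb : Function.Injective b) (hdiag : ∀ i, A i i = 1) : A.det = 1 := by
  rw [hA.det]
  refine Finset.prod_eq_one fun a ha => ?_
  obtain ⟨i, -, rfl⟩ := Finset.mem_image.1 ha
  let : Unique {j // b j = b i} := ⟨⟨⟨i, rfl⟩⟩, fun j => Subtype.ext (hb j.2)⟩
  rw [Matrix.det_unique]
  exact hdiag i

/-- The height at `i ∈ ℤ` of the path with values `w` on `{1, …, K}` and zero elsewhere. -/
def pathAt (K : ℕ) (i : ℤ) : (Fin K → ℝ) →ₗ[ℝ] ℝ :=
  if h : 1 ≤ i ∧ i ≤ K then LinearMap.proj ⟨i.toNat - 1, by omega⟩ else 0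

lemma pathAt_single {K : ℕ} (i : ℤ) (j : Fin K) :
    pathAt K i (Pi.single j 1) = if i = j + 1 then 1 else 0 := by
  unfold pathAt
  split_ifs with h h' h'
  · have : (⟨i.toNat - 1, by omega⟩ : Fin K) = j := Fin.ext (by simp only; omega)
    simp [this]
  · have : (⟨i.toNat - 1, by omega⟩ : Fin K) ≠ j := fun e => by
      have := congrArg Fin.val e
      simp only at this
      omega
    simp [this]
  · have := j.2
    omega
  · simp

lemma pathAt_natCast_add_one {K : ℕ} (w : Fin K → ℝ) (i : Fin K) :
    pathAt K (i + 1) w = w i := by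
  have := i.2
  rw [pathAt, dif_pos (by omega)]
  simp only [LinearMap.proj_apply]
  congr 1

lemma pathAt_of_nonpos {K : ℕ} (w : Fin K → ℝ) {i : ℤ} (hi : i ≤ 0) : pathAt K i w = 0 := by
  rw [pathAt, dif_neg (by omega), LinearMap.zero_apply]

lemma pathAt_of_lt {K : ℕ} (w : Fin K → ℝ) {i : ℤ} (hi : K < i) : pathAt K i w = 0 := by
  rw [pathAt, dif_neg (by omega), LinearMap.zero_apply]

lemma fExt_zero_zero_eq_pathAt {K : ℕ} (w : Fin K → ℝ) (i : ℤ) :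
    fExt 0 0 (K + 2) w i = pathAt K i w := by
  unfold fExt pathAt
  push_cast
  split_ifs <;> first | rfl | omega

/-- The discrete Laplacian of the path, at `m ∈ ℤ`. -/
def lapAt (K : ℕ) (m : ℤ) : (Fin K → ℝ) →ₗ[ℝ] ℝ :=
  pathAt K (m + 1) + pathAt K (m - 1) - (2 : ℝ) • pathAt K m

lemma lapAt_apply {K : ℕ} (m : ℤ) (w : Fin K → ℝ) :
    lapAt K m w = pathAt K (m + 1) w + pathAt K (m - 1) w - 2 * pathAt K m w := by
  simp [lapAt]

/-- All the discrete Laplacians of the path, except those at `M` and `M + 1`. -/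
def lapMap (M N : ℕ) : (Fin (M + N) → ℝ) →ₗ[ℝ] Fin (M + N) → ℝ :=
  LinearMap.pi fun i => lapAt (M + N) (if (i : ℕ) < M then i else i + 2)

lemma lapMap_apply {M N : ℕ} (w : Fin (M + N) → ℝ) (i : Fin (M + N)) :
    lapMap M N w i = lapAt (M + N) (if (i : ℕ) < M then i else i + 2) w := rfl

lemma det_lapMap (M N : ℕ) : LinearMap.det (lapMap M N) = 1 := by
  rw [← LinearMap.det_toMatrix']
  refine det_eq_one_of_blockTriangular_injective
    (b := fun i : Fin (M + N) => if (i : ℕ) < M then -(i : ℤ) - 1 else i) ?_ ?_ ?_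
  · intro i j hij
    rw [LinearMap.toMatrix'_apply]
    simp only [lapMap_apply, lapAt_apply] at hij ⊢
    simp only [pathAt_single]
    split_ifs at hij ⊢ <;> first | omega | norm_num
  · intro i j hij
    ext
    simp only at hij
    split_ifs at hij <;> omega
  · intro i
    rw [LinearMap.toMatrix'_apply]
    simp only [lapMap_apply, lapAt_apply]
    simp only [pathAt_single]
    split_ifs <;> first | omega | norm_num

lemma measurePreserving_lapMap (M N : ℕ) : MeasurePreserving (lapMap M N) := by
  refine ⟨(lapMap M N).continuous_of_finiteDimensional.measurable, ?_⟩
  rw [Real.map_linearMap_volume_pi_eq_smul_volume_pi (by simp [det_lapMap])]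
  simp [det_lapMap]

/-- A function on `ℤ` that vanishes at `-1` and `0` is the integrated walk of its Laplacians. -/
lemma eq_integratedWalk_of_laplacian_eq {N : ℕ} {ξ : Fin N → ℝ} {g : ℤ → ℝ} (h0 : g 0 = 0)
    (h1 : g (-1) = 0) (h : ∀ j < N, g (j + 1) + g (j - 1) - 2 * g j = stepAt ξ j) :
    ∀ k ≤ N, g k = integratedWalk ξ k ∧ g k - g (k - 1) = walk ξ k := by
  intro k
  induction k with
  | zero => simp [h0, h1, integratedWalk, walk]
  | succ k ih =>
    intro hk
    obtain ⟨ih₁, ih₂⟩ := ih (by omega)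
    have hs := h k (by omega)
    rw [integratedWalk_succ, walk_succ, ← ih₁, ← ih₂, ← hs]
    push_cast
    rw [add_sub_cancel_right]
    constructor <;> ring

lemma prod_Icc_eq_mul_prod_fin {M N : ℕ} (f : ℤ → ℝ) :
    ∏ m ∈ Finset.Icc (0 : ℤ) (M + N + 1), f m =
      (∏ i : Fin (M + N), f (if (i : ℕ) < M then i else i + 2)) * (f M * f (M + 1)) := by
  have e : ∏ m ∈ Finset.Icc (0 : ℤ) (M + N + 1), f m =
      ∏ j ∈ Finset.range (M + 2 + N), f j := by
    refine (Finset.prod_bij (fun (j : ℕ) _ => (j : ℤ)) ?_ ?_ ?_ fun _ _ => rfl).symm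
    · intro j hj
      simp only [Finset.mem_range, Finset.mem_Icc] at hj ⊢
      omega
    · intro i _ j _ hij
      exact_mod_cast hij
    · intro m hm
      simp only [Finset.mem_range, Finset.mem_Icc] at hm ⊢
      exact ⟨m.toNat, by omega, by omega⟩
  rw [e, Finset.prod_range_add, Finset.prod_range_succ, Finset.prod_range_succ, Fin.prod_univ_add,
    Finset.prod_range, Finset.prod_range]
  simp only [Fin.val_castAdd, Fin.is_lt, if_true, Fin.val_natAdd, add_lt_iff_neg_left,
    not_lt_zero, if_false]
  push_cast
  simp only [add_right_comm]
  ring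

end Laplacian

section Density

lemma lintegral_pi_fin_prod {n : ℕ} {f : Fin n → ℝ → ℝ≥0∞} (hf : ∀ i, Measurable (f i)) :
    ∫⁻ x : Fin n → ℝ, ∏ i, f i (x i) = ∏ i, ∫⁻ x, f i x := by
  induction n with
  | zero => simp [volume_pi]
  | succ n ih =>
    have hmp := (volume_preserving_piFinSuccAbove (fun _ : Fin (n + 1) => ℝ) 0).symm
    have hf' : Measurable fun x : Fin n → ℝ => ∏ i : Fin n, f i.succ (x i) :=
      Finset.measurable_fun_prod _ fun i _ => (hf _).comp (measurable_pi_apply i)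
    rw [← hmp.lintegral_comp (by fun_prop), Fin.prod_univ_succ, ← ih fun i => hf _,
      Measure.volume_eq_prod, ← lintegral_prod_mul (hf 0).aemeasurable hf'.aemeasurable]
    simp [Fin.prod_univ_succ, MeasurableEquiv.piFinSuccAbove_symm_apply, Fin.insertNthEquiv]

lemma stepLaw_withDensity {f : ℝ → ℝ≥0∞} (hf : Measurable f)
    [SigmaFinite (volume.withDensity f)] (n : ℕ) :
    stepLaw (volume.withDensity f) n =
      volume.withDensity fun x : Fin n → ℝ => ∏ i, f (x i) := by
  refine (Measure.pi_eq fun s hs => ?_)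
  rw [withDensity_apply _ (.univ_pi hs), ← lintegral_indicator (.univ_pi hs)]
  simp only [withDensity_apply _ (hs _), ← lintegral_indicator (hs _)]
  rw [← lintegral_pi_fin_prod fun i => hf.indicator (hs i)]
  refine lintegral_congr fun x => ?_
  by_cases hx : x ∈ Set.pi univ s
  · rw [indicator_of_mem hx]
    exact Finset.prod_congr rfl fun i _ => (indicator_of_mem (hx i trivial) _).symm
  · rw [indicator_of_notMem hx]
    obtain ⟨i, -, hi⟩ : ∃ i, i ∈ univ ∧ x i ∉ s i := by simpa [Set.mem_pi] using hx
    exact (Finset.prod_eq_zero (Finset.mem_univ i) (indicator_of_notMem hi _)).symm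

end Density

section DoubleZero

/-- The density of a double zero path, split into the Laplacians collected by `lapMap` and the
two remaining ones. -/
lemma prod_fExt_zero_zero (E : ℝ → ℝ) (M N : ℕ) (w : Fin (M + N) → ℝ) :
    ∏ m ∈ Finset.Icc (0 : ℤ) (((M + N + 2 : ℕ) : ℤ) - 1),
      E (fExt 0 0 (M + N + 2) w (m + 1) + fExt 0 0 (M + N + 2) w (m - 1)
        - 2 * fExt 0 0 (M + N + 2) w m) =
      (∏ i, E (lapMap M N w i)) * (E (lapAt (M + N) M w) * E (lapAt (M + N) (M + 1) w)) := by
  have e : ((M + N + 2 : ℕ) : ℤ) - 1 = M + N + 1 := by push_cast; ring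
  rw [e]
  simp only [fExt_zero_zero_eq_pathAt, ← lapAt_apply]
  exact prod_Icc_eq_mul_prod_fin fun m => E (lapAt (M + N) m w)

/-- If the two halves of a path, the second one seen from its end, are half paths ending near
the same height, then the path is nonnegative and its two middle Laplacians are small. -/
lemma nonneg_and_abs_lapAt_le {M N : ℕ} {δ z : ℝ} {w : Fin (M + N) → ℝ}
    (hξ : lapMap M N w ∘ Fin.castAdd N ∈ halfPathSet M δ z)
    (hη : lapMap M N w ∘ Fin.natAdd M ∘ Fin.rev ∈ halfPathSet N δ z) :
    (∀ i, 0 ≤ w i) ∧ |lapAt (M + N) M w| ≤ 5 * δ ∧ |lapAt (M + N) (M + 1) w| ≤ 5 * δ := by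
  have hφ := eq_integratedWalk_of_laplacian_eq (ξ := lapMap M N w ∘ Fin.castAdd N)
    (g := fun i => pathAt (M + N) i w) (pathAt_of_nonpos w le_rfl)
    (pathAt_of_nonpos w (by norm_num)) fun j hj => by
      simp [stepAt, hj, lapMap_apply, lapAt_apply]
  have hψ := eq_integratedWalk_of_laplacian_eq (ξ := lapMap M N w ∘ Fin.natAdd M ∘ Fin.rev)
    (g := fun i => pathAt (M + N) (M + N + 1 - i) w) (pathAt_of_lt w (by push_cast; omega))
    (pathAt_of_lt w (by push_cast; omega)) fun j hj => by
      have e : (M : ℤ) + (N - (j + 1) : ℕ) + 2 = M + N + 1 - j := by omega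
      simp only [stepAt, hj, dif_pos, Function.comp_apply, lapMap_apply, lapAt_apply,
        Fin.val_natAdd, Fin.val_rev, add_lt_iff_neg_left, not_lt_zero, if_false]
      push_cast
      rw [e, show (M : ℤ) + N + 1 - (j + 1) = M + N + 1 - j - 1 by ring,
        show (M : ℤ) + N + 1 - (j - 1) = M + N + 1 - j + 1 by ring]
      ring
  obtain ⟨hξ₀, hξ₁, hξ₂⟩ := hξ
  obtain ⟨hη₀, hη₁, hη₂⟩ := hη
  have hφM := hφ M le_rfl
  have hψN := hψ N le_rfl
  have hξM := hξ₀ M le_rfl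
  have hηN := hη₀ N le_rfl
  rw [← hφM.1] at hξ₂
  rw [← hψN.1] at hη₂
  rw [← hφM.2] at hξ₁ hξM
  rw [← hψN.2] at hη₁ hηN
  rw [show (M : ℤ) + N + 1 - N = M + 1 by ring] at hη₂ hη₁ hηN
  rw [show (M : ℤ) + N + 1 - (N - 1) = M + 1 + 1 by ring] at hη₁ hηN
  refine ⟨fun i => ?_, ?_, ?_⟩
  · rw [← pathAt_natCast_add_one w i]
    rcases lt_or_ge (i : ℕ) M with hi | hi
    · have := (hφ (i + 1) hi).1
      push_cast at this
      rw [this]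
      exact integratedWalk_nonneg hξ₀ hi
    · have h2 := i.2
      have := (hψ (M + N - i) (by omega)).1
      rw [show (M : ℤ) + N + 1 - (M + N - i : ℕ) = i + 1 by omega] at this
      rw [this]
      exact integratedWalk_nonneg hη₀ (by omega)
  · rw [lapAt_apply, abs_le]
    constructor <;> linarith [hξ₂.1, hξ₂.2, hη₂.1, hη₂.2]
  · rw [lapAt_apply, abs_le, add_sub_cancel_right]
    constructor <;> linarith [hξ₂.1, hξ₂.2, hη₂.1, hη₂.2]

variable {E : ℝ → ℝ}

lemma setLIntegral_prod_lapMap (hE : Measurable E)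
    [SigmaFinite (volume.withDensity fun x => ENNReal.ofReal (E x))] {M N : ℕ}
    {S : Set (Fin (M + N) → ℝ)} (hS : MeasurableSet S) :
    ∫⁻ w in lapMap M N ⁻¹' S, ∏ i, ENNReal.ofReal (E (lapMap M N w i)) =
      stepLaw (volume.withDensity fun x => ENNReal.ofReal (E x)) (M + N) S := by
  have hm : Measurable fun x : Fin (M + N) → ℝ => ∏ i, ENNReal.ofReal (E (x i)) := by fun_prop
  rw [stepLaw_withDensity hE.ennreal_ofReal, withDensity_apply _ hS]
  exact (measurePreserving_lapMap M N).setLIntegral_comp_preimage hS hm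

lemma lintegral_doubleZero_le (hE0 : ∀ x, 0 ≤ E x) (hE : Measurable E)
    [IsProbabilityMeasure (volume.withDensity fun x => ENNReal.ofReal (E x))] {B : ℝ}
    (hB : ∀ x, E x ≤ B) (M N : ℕ) :
    ∫⁻ w, ENNReal.ofReal ((∏ i, E (lapMap M N w i)) *
      (E (lapAt (M + N) M w) * E (lapAt (M + N) (M + 1) w))) ≤ ENNReal.ofReal (B ^ 2) := by
  have hB0 : 0 ≤ B := (hE0 0).trans (hB 0)
  calc _ ≤ ∫⁻ w, ENNReal.ofReal (B ^ 2) * ∏ i, ENNReal.ofReal (E (lapMap M N w i)) := by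
        refine lintegral_mono fun w => ?_
        rw [ENNReal.ofReal_mul (Finset.prod_nonneg fun _ _ => hE0 _), mul_comm,
          ENNReal.ofReal_prod_of_nonneg fun _ _ => hE0 _, sq]
        gcongr
        exacts [hE0 _, hB _, hB _]
    _ = ENNReal.ofReal (B ^ 2) := by
        rw [lintegral_const_mul' _ _ ENNReal.ofReal_ne_top, ← setLIntegral_univ, ← preimage_univ,
          setLIntegral_prod_lapMap hE .univ, measure_univ, mul_one]

lemma le_setLIntegral_doubleZero (hE0 : ∀ x, 0 ≤ E x) (hE : Measurable E)
    [IsProbabilityMeasure (volume.withDensity fun x => ENNReal.ofReal (E x))] {δ ε z : ℝ}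
    (hε : 0 ≤ ε) (hεE : ∀ x, |x| ≤ 5 * δ → ε ≤ E x) (M N : ℕ) :
    ENNReal.ofReal (ε ^ 2) *
      stepLaw (volume.withDensity fun x => ENNReal.ofReal (E x)) (M + N)
        {x | x ∘ Fin.castAdd N ∈ halfPathSet M δ z ∧
          x ∘ Fin.natAdd M ∘ Fin.rev ∈ halfPathSet N δ z} ≤
      ∫⁻ w in {w : Fin (M + N) → ℝ | ∀ i, 0 ≤ w i}, ENNReal.ofReal ((∏ i, E (lapMap M N w i)) *
        (E (lapAt (M + N) M w) * E (lapAt (M + N) (M + 1) w))) := by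
  have hS := measurableSet_glue (measurableSet_halfPathSet M δ z) (measurableSet_halfPathSet N δ z)
  have hL := (measurePreserving_lapMap M N).measurable
  rw [← setLIntegral_prod_lapMap hE hS, ← lintegral_const_mul' _ _ ENNReal.ofReal_ne_top]
  refine le_trans (setLIntegral_mono' (hL hS) fun w hw => ?_)
    (lintegral_mono_set fun w hw => (nonneg_and_abs_lapAt_le hw.1 hw.2).1)
  obtain ⟨-, h₁, h₂⟩ := nonneg_and_abs_lapAt_le hw.1 hw.2
  rw [ENNReal.ofReal_mul (Finset.prod_nonneg fun _ _ => hE0 _), mul_comm,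
    ENNReal.ofReal_prod_of_nonneg fun _ _ => hE0 _, sq]
  gcongr
  exacts [hE0 _, hεE _ h₁, hεE _ h₂]

end DoubleZero

/-- Equation (2.13): there are `c > 0` and `c_- > 0` such that for every `n ≥ 3`,
`f^w_{0,0}(n) ≥ (c/n^{c_-}) f^p_{0,0}(n)`. -/
theorem double_zero_repulsion_lower_bound
    (E : ℝ → ℝ) (σ : ℝ)
    (hE_nonneg : ∀ x, 0 ≤ E x) (hE_cont : Continuous E)
    (hE_bdd : ∃ M, ∀ x, E x ≤ M) (hE_pos : 0 < E 0)
    (hE_int : Integrable E) (hE_mass : ∫ x, E x = 1)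
    (hE_mom1 : Integrable fun x => x * E x) (hE_mean : ∫ x, x * E x = 0)
    (hE_mom2 : Integrable fun x => x ^ 2 * E x) (hE_var : ∫ x, x ^ 2 * E x = σ ^ 2)
    (hσ : 0 < σ)
 :
    ∃ c cm : ℝ, 0 < c ∧ 0 < cm ∧ ∀ n : ℕ, 3 ≤ n →
      (c / (n : ℝ) ^ cm) * fpinZero E n ≤ fwetZero E n := by
  obtain ⟨B, hB⟩ := hE_bdd
  have hB0 : 0 < B := hE_pos.trans_le (hB 0)
  have hEm : Measurable E := hE_cont.measurable
  set ν : Measure ℝ := volume.withDensity fun x => ENNReal.ofReal (E x) with hν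
  have hνp : IsProbabilityMeasure ν := by
    refine ⟨?_⟩
    rw [hν, withDensity_apply _ .univ, setLIntegral_univ,
      ← ofReal_integral_eq_lintegral_ofReal hE_int (.of_forall hE_nonneg), hE_mass,
      ENNReal.ofReal_one]
  have hνint (g : ℝ → ℝ) : ∫ x, g x ∂ν = ∫ x, g x * E x := by
    rw [hν, integral_withDensity_eq_integral_toReal_smul hEm.ennreal_ofReal
      (.of_forall fun _ => ENNReal.ofReal_lt_top)]
    simp [ENNReal.toReal_ofReal (hE_nonneg _), mul_comm]
  have hL2 : MemLp id 2 ν := by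
    rw [memLp_two_iff_integrable_sq aestronglyMeasurable_id, hν,
      integrable_withDensity_iff hEm.ennreal_ofReal (.of_forall fun _ => ENNReal.ofReal_lt_top)]
    simpa [ENNReal.toReal_ofReal (hE_nonneg _)] using hE_mom2
  obtain ⟨r, hr, hrE⟩ : ∃ r > 0, ∀ x, |x| < r → E 0 / 2 < E x := by
    obtain ⟨r, hr, h⟩ := Metric.eventually_nhds_iff.1
      ((hE_cont.tendsto 0).eventually_const_lt (half_lt_self hE_pos))
    exact ⟨r, hr, fun x hx => h (by simpa [Real.dist_eq] using hx)⟩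
  set ε : ℝ := E 0 / 2
  have hε : 0 < ε := half_pos hE_pos
  set δ : ℝ := r / 6
  have hδ : 0 < δ := by positivity
  have hεE (x : ℝ) (hx : |x| ≤ 5 * δ) : ε ≤ E x := (hrE x (by simp only [δ] at hx; linarith)).le
  have hdens (a b : ℝ) (ha : -δ ≤ a) (hab : a ≤ b) (hb : b ≤ δ) :
      ENNReal.ofReal (ε * (b - a)) ≤ ν (Icc a b) := by
    rw [hν, withDensity_apply _ measurableSet_Icc, ENNReal.ofReal_mul hε.le, ← Real.volume_Icc,
      ← setLIntegral_const]
    refine setLIntegral_mono' measurableSet_Icc fun x hx => ENNReal.ofReal_le_ofReal (hεE x ?_)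
    rw [abs_le]
    constructor <;> linarith [hx.1, hx.2]
  obtain ⟨c, hc, C, h⟩ := exists_poly_le_stepLaw_glue_halfPathSet hσ hL2
    (by rw [hνint]; exact hE_mean) (by rw [hνint]; exact hE_var) hδ hε hdens
  refine ⟨ε ^ 2 * c / B ^ 2, C + 1, by positivity, by positivity, fun n hn => ?_⟩
  obtain ⟨M, N, hMN, hNM, rfl⟩ : ∃ M N : ℕ, M ≤ N ∧ N ≤ M + 1 ∧ n = M + N + 2 :=
    ⟨(n - 2) / 2, n - 2 - (n - 2) / 2, by omega, by omega, by omega⟩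
  obtain ⟨z, hz⟩ := h M N hMN hNM
  set F : (Fin (M + N) → ℝ) → ℝ := fun w => (∏ i, E (lapMap M N w i)) *
    (E (lapAt (M + N) M w) * E (lapAt (M + N) (M + 1) w)) with hF
  have hF0 (w) : 0 ≤ F w := mul_nonneg (Finset.prod_nonneg fun _ _ => hE_nonneg _)
    (mul_nonneg (hE_nonneg _) (hE_nonneg _))
  have hFm : Measurable F := by
    have h₁ := (measurePreserving_lapMap M N).measurable
    have h₂ (m : ℤ) : Measurable (lapAt (M + N) m) :=
      (lapAt (M + N) m).continuous_of_finiteDimensional.measurable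
    fun_prop
  have hle := lintegral_doubleZero_le hE_nonneg hEm hB M N
  have hge := (mul_le_mul_right hz (ENNReal.ofReal (ε ^ 2))).trans
    (le_setLIntegral_doubleZero hE_nonneg hEm hε.le hεE M N)
  rw [← ENNReal.ofReal_mul (by positivity)] at hge
  have hpin : fpinZero E (M + N + 2) ≤ B ^ 2 := by
    have e : fpinZero E (M + N + 2) = ∫ w, F w :=
      integral_congr_ae (.of_forall fun w => prod_fExt_zero_zero E M N w)
    rw [e, integral_eq_lintegral_of_nonneg_ae (.of_forall hF0) hFm.aestronglyMeasurable]
    exact ENNReal.toReal_le_of_le_ofReal (by positivity) hle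
  have hwet : ε ^ 2 * (c / (M + 1) ^ C) ≤ fwetZero E (M + N + 2) := by
    have e : fwetZero E (M + N + 2) = ∫ w in {w : Fin (M + N) → ℝ | ∀ i, 0 ≤ w i}, F w :=
      integral_congr_ae (.of_forall fun w => prod_fExt_zero_zero E M N w)
    rw [e, integral_eq_lintegral_of_nonneg_ae (.of_forall hF0) hFm.aestronglyMeasurable]
    exact (ENNReal.ofReal_le_iff_le_toReal
      (((setLIntegral_le_lintegral _ _).trans hle).trans_lt ENNReal.ofReal_lt_top).ne).1 hge
  have hn1 : (1 : ℝ) ≤ (M + N + 2 : ℕ) := by norm_cast; omega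
  have hpow : ((M : ℝ) + 1) ^ C ≤ ((M + N + 2 : ℕ) : ℝ) ^ ((C : ℝ) + 1) := by
    rw [← Real.rpow_natCast]
    refine (Real.rpow_le_rpow (by positivity) ?_ (by positivity)).trans
      (Real.rpow_le_rpow_of_exponent_le hn1 (by linarith))
    push_cast
    linarith [N.cast_nonneg (α := ℝ)]
  calc _ ≤ ε ^ 2 * c / B ^ 2 / ((M + N + 2 : ℕ) : ℝ) ^ ((C : ℝ) + 1) * B ^ 2 := by gcongr
    _ = ε ^ 2 * (c / ((M + N + 2 : ℕ) : ℝ) ^ ((C : ℝ) + 1)) := by field_simp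
    _ ≤ ε ^ 2 * (c / (M + 1) ^ C) := by gcongr
    _ ≤ _ := hwet
end
end

section
/- Polynomial lower bound for the free partition functions: there exist constants c > 0 and c_− > 0 such that for every N ∈ ℕ, Z^p_{0,N} ≥ Z^w_{0,N} ≥ c / N^{2 + c_−}. -/
open MeasureTheory Filter Topology Set
open scoped ENNReal NNReal BigOperators

noncomputable section

/-- The field `(φ_1, …, φ_{N-1})` extended to `ℤ` with zero boundary conditions
`φ_{-1} = φ_0 = φ_N = φ_{N+1} = 0`. -/
def fieldExt (N : ℕ) (φ : Fin (N - 1) → ℝ) (i : ℤ) : ℝ :=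
  if h : 0 < i ∧ i < (N : ℤ) then φ ⟨i.toNat - 1, by omega⟩ else 0

/-- `exp(−H_{[−1,N+1]}(φ))` with zero boundary conditions, where `E = exp(−V)` and
`H_{[a,b]}(φ) = ∑_{n=a+1}^{b-1} V(φ_{n+1} + φ_{n-1} - 2 φ_n)`. -/
def hamWeight (E : ℝ → ℝ) (N : ℕ) (φ : Fin (N - 1) → ℝ) : ℝ :=
  ∏ n ∈ Finset.Icc (0 : ℤ) (N : ℤ),
    E (fieldExt N φ (n + 1) + fieldExt N φ (n - 1) - 2 * fieldExt N φ n)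

/-- the single-site reference measure `ε δ_0(dx) + dx` of the pinning model -/
def pinFactor (ε : ℝ) : Measure ℝ :=
  ENNReal.ofReal ε • Measure.dirac 0 + volume

/-- the single-site reference measure `ε δ_0(dx) + dx 1_{(x ≥ 0)}` of the wetting model -/
def wetFactor (ε : ℝ) : Measure ℝ :=
  ENNReal.ofReal ε • Measure.dirac 0 + volume.restrict (Ici 0)

/-- the pinning partition function `Z^p_{ε,N}` -/
def Zpin (E : ℝ → ℝ) (ε : ℝ) (N : ℕ) : ℝ :=
  ∫ φ : Fin (N - 1) → ℝ, hamWeight E N φ ∂(Measure.pi fun _ => pinFactor ε)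

/-- the wetting partition function `Z^w_{ε,N}` -/
def Zwet (E : ℝ → ℝ) (ε : ℝ) (N : ℕ) : ℝ :=
  ∫ φ : Fin (N - 1) → ℝ, hamWeight E N φ ∂(Measure.pi fun _ => wetFactor ε)

/-- The weight of a path `u, v, φ 0, …, φ (m-1), 0, 0`, built up one step at a time. -/
def chainWeight (E : ℝ → ℝ) : (m : ℕ) → ℝ → ℝ → (Fin m → ℝ) → ℝ
  | 0, u, v, _ => E (u - 2 * v) * E v
  | m + 1, u, v, φ => E (φ 0 + u - 2 * v) * chainWeight E m v (φ 0) (Fin.tail φ)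

/-- The total weight of all paths with `m` free sites in `A` that start from the two heights
`u, v` and end with two zeros. -/
def pathMass (E : ℝ → ℝ) (A : Set ℝ) : ℕ → ℝ → ℝ → ℝ≥0∞
  | 0, u, v => ENNReal.ofReal (E (u - 2 * v) * E v)
  | m + 1, u, v => ∫⁻ w in A, ENNReal.ofReal (E (w + u - 2 * v)) * pathMass E A m v w

lemma chainWeight_nonneg {E : ℝ → ℝ} (hE : ∀ x, 0 ≤ E x) (m : ℕ) (u v : ℝ) (φ : Fin m → ℝ) :
    0 ≤ chainWeight E m u v φ := by
  induction m generalizing u v with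
  | zero => exact mul_nonneg (hE _) (hE _)
  | succ m ih => exact mul_nonneg (hE _) (ih _ _ _)

lemma continuous_chainWeight {E : ℝ → ℝ} (hE : Continuous E) (m : ℕ) :
    Continuous fun p : ℝ × ℝ × (Fin m → ℝ) => chainWeight E m p.1 p.2.1 p.2.2 := by
  induction m with
  | zero => simp only [chainWeight]; fun_prop
  | succ m ih =>
    simp only [chainWeight]
    refine Continuous.mul (by fun_prop) (ih.comp
      (g := fun p : ℝ × ℝ × (Fin m → ℝ) => chainWeight E m p.1 p.2.1 p.2.2)
      (f := fun p : ℝ × ℝ × (Fin (m + 1) → ℝ) => (p.2.1, p.2.2 0, Fin.tail p.2.2)) ?_)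
    unfold Fin.tail
    fun_prop

lemma lintegral_chainWeight {E : ℝ → ℝ} (hE : Continuous E) (hE0 : ∀ x, 0 ≤ E x) (A : Set ℝ)
    (m : ℕ) (u v : ℝ) :
    ∫⁻ φ, ENNReal.ofReal (chainWeight E m u v φ)
      ∂(Measure.pi fun _ : Fin m => (volume.restrict A : Measure ℝ)) = pathMass E A m u v := by
  induction m generalizing u v with
  | zero => simp [chainWeight, pathMass]
  | succ m ih =>
    have hmp := measurePreserving_piFinSuccAbove
      (fun _ : Fin (m + 1) => (volume.restrict A : Measure ℝ)) 0
    have hcont : Continuous fun p : ℝ × (Fin m → ℝ) =>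
        E (p.1 + u - 2 * v) * chainWeight E m v p.1 p.2 :=
      Continuous.mul (by fun_prop) ((continuous_chainWeight hE m).comp
        (g := fun p : ℝ × ℝ × (Fin m → ℝ) => chainWeight E m p.1 p.2.1 p.2.2)
        (f := fun p : ℝ × (Fin m → ℝ) => (v, p.1, p.2)) (by fun_prop))
    have hmeas : Measurable fun p : ℝ × (Fin m → ℝ) =>
        ENNReal.ofReal (E (p.1 + u - 2 * v) * chainWeight E m v p.1 p.2) :=
      hcont.measurable.ennreal_ofReal
    have := hmp.lintegral_comp hmeas
    calc _ = _ := this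
      _ = _ := by
        rw [lintegral_prod _ hmeas.aemeasurable]
        simp only [pathMass]
        refine lintegral_congr fun w => ?_
        simp only [ENNReal.ofReal_mul (hE0 _)]
        rw [lintegral_const_mul' _ _ ENNReal.ofReal_ne_top, ih]

lemma pathMass_le {E : ℝ → ℝ} (hE0 : ∀ x, 0 ≤ E x) (hE_int : Integrable E)
    (hE_mass : ∫ x, E x = 1) {M : ℝ} (hM : ∀ x, E x ≤ M) (A : Set ℝ) (m : ℕ) (u v : ℝ) :
    pathMass E A m u v ≤ ENNReal.ofReal (M * M) := by
  induction m generalizing u v with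
  | zero =>
    exact ENNReal.ofReal_le_ofReal (mul_le_mul (hM _) (hM _) (hE0 _) ((hE0 0).trans (hM 0)))
  | succ m ih =>
    calc pathMass E A (m + 1) u v
        ≤ ∫⁻ w in A, ENNReal.ofReal (E (w + u - 2 * v)) * ENNReal.ofReal (M * M) :=
          lintegral_mono fun w => mul_le_mul_right (ih v w) _
      _ ≤ ∫⁻ w, ENNReal.ofReal (E (w + u - 2 * v)) * ENNReal.ofReal (M * M) :=
          setLIntegral_le_lintegral _ _
      _ = (∫⁻ w, ENNReal.ofReal (E (w + (u - 2 * v)))) * ENNReal.ofReal (M * M) := by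
          rw [lintegral_mul_const' _ _ ENNReal.ofReal_ne_top]
          simp only [add_sub_assoc]
      _ = ENNReal.ofReal (M * M) := by
          rw [lintegral_add_right_eq_self (fun w => ENNReal.ofReal (E w)),
            ← ofReal_integral_eq_lintegral_ofReal hE_int (ae_of_all _ hE0), hE_mass]
          simp

lemma pathMass_mono_set (E : ℝ → ℝ) {A B : Set ℝ} (h : A ⊆ B) (m : ℕ) (u v : ℝ) :
    pathMass E A m u v ≤ pathMass E B m u v := by
  induction m generalizing u v with
  | zero => exact le_rfl
  | succ m ih =>
    exact lintegral_mono' (Measure.restrict_mono h le_rfl) fun w => mul_le_mul_right (ih v w) _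

/-- The path `u, v, φ 0, …, φ (m-1), 0, 0, …` as a sequence. -/
def chainSeq (m : ℕ) (u v : ℝ) (φ : Fin m → ℝ) : ℕ → ℝ
  | 0 => u
  | 1 => v
  | k + 2 => if h : k < m then φ ⟨k, h⟩ else 0

lemma chainWeight_eq_prod (E : ℝ → ℝ) (m : ℕ) (u v : ℝ) (φ : Fin m → ℝ) :
    chainWeight E m u v φ = ∏ k ∈ Finset.range (m + 2),
      E (chainSeq m u v φ (k + 2) + chainSeq m u v φ k - 2 * chainSeq m u v φ (k + 1)) := by
  induction m generalizing u v with
  | zero => simp [chainWeight, Finset.prod_range_succ, chainSeq]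
  | succ m ih =>
    have hshift : ∀ k, chainSeq (m + 1) u v φ (k + 1) = chainSeq m v (φ 0) (Fin.tail φ) k := by
      intro k
      match k with
      | 0 => rfl
      | 1 => simp [chainSeq]
      | k + 2 => simp [chainSeq, Fin.tail]
    rw [Finset.prod_range_succ', chainWeight, ih, mul_comm]
    simp only [hshift, show ∀ k, k + 1 + 2 = (k + 2) + 1 from fun _ => rfl]
    simp [chainSeq]

lemma hamWeight_eq_chainWeight (E : ℝ → ℝ) (m : ℕ) (φ : Fin m → ℝ) :
    hamWeight E (m + 1) φ = chainWeight E m 0 0 φ := by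
  have hseq : ∀ k : ℕ, chainSeq m 0 0 φ k = fieldExt (m + 1) φ ((k : ℤ) - 1) := by
    intro k
    match k with
    | 0 => simp [chainSeq, fieldExt]
    | 1 => simp [chainSeq, fieldExt]
    | k + 2 =>
      simp only [chainSeq, fieldExt]
      by_cases h : k < m
      · rw [dif_pos h, dif_pos (by push_cast; omega)]
        congr 2
        omega
      · rw [dif_neg h, dif_neg (by push_cast; omega)]
  rw [chainWeight_eq_prod, hamWeight]
  symm
  refine Finset.prod_bij (fun k _ => (k : ℤ)) ?_ ?_ ?_ ?_
  · intro k hk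
    simp only [Finset.mem_range] at hk
    simp only [Finset.mem_Icc]
    push_cast
    omega
  · intro a _ b _ h
    exact_mod_cast h
  · intro b hb
    simp only [Finset.mem_Icc] at hb
    push_cast at hb
    exact ⟨b.toNat, by simp only [Finset.mem_range]; omega, by omega⟩
  · intro k _
    rw [hseq, hseq, hseq]
    push_cast
    ring_nf

lemma integral_hamWeight {E : ℝ → ℝ} (hE : Continuous E) (hE0 : ∀ x, 0 ≤ E x) (A : Set ℝ)
    (m : ℕ) :
    ∫ φ : Fin m → ℝ, hamWeight E (m + 1) φ
      ∂(Measure.pi fun _ : Fin m => (volume.restrict A : Measure ℝ)) =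
      (pathMass E A m 0 0).toReal := by
  have hcont : Continuous (chainWeight E m 0 0) :=
    (continuous_chainWeight hE m).comp
      (f := fun φ : Fin m → ℝ => ((0 : ℝ), (0 : ℝ), φ)) (by fun_prop)
  simp only [hamWeight_eq_chainWeight]
  rw [integral_eq_lintegral_of_nonneg_ae (ae_of_all _ fun φ => chainWeight_nonneg hE0 m 0 0 φ)
    hcont.measurable.aestronglyMeasurable, lintegral_chainWeight hE hE0]

lemma Zwet_zero {E : ℝ → ℝ} (hE : Continuous E) (hE0 : ∀ x, 0 ≤ E x) (m : ℕ) :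
    Zwet E 0 (m + 1) = (pathMass E (Ici 0) m 0 0).toReal := by
  rw [← integral_hamWeight hE hE0]
  simp [Zwet, wetFactor]

lemma Zpin_zero {E : ℝ → ℝ} (hE : Continuous E) (hE0 : ∀ x, 0 ≤ E x) (m : ℕ) :
    Zpin E 0 (m + 1) = (pathMass E univ m 0 0).toReal := by
  rw [← integral_hamWeight hE hE0]
  simp [Zpin, pinFactor]

lemma ofReal_integral_le_lintegral {f : ℝ → ℝ} (hf : Integrable f) :
    ENNReal.ofReal (∫ x, f x) ≤ ∫⁻ x, ENNReal.ofReal (f x) := by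
  rw [integral_eq_lintegral_pos_part_sub_lintegral_neg_part hf]
  refine (ENNReal.ofReal_le_ofReal (sub_le_self _ ENNReal.toReal_nonneg)).trans ?_
  exact ENNReal.ofReal_toReal_le

/-- Starting from the heights `u, v`, with probability at least `p` the slope of the path stays
for `n` steps within `ρ` of the line with slope increment `α`; expressed as a lower bound on
`pathMass` that is valid as soon as all such paths stay nonnegative. -/
def TubeBound (E : ℝ → ℝ) (n : ℕ) (α ρ p : ℝ) : Prop :=
  ∀ (m : ℕ) (u v b : ℝ), 0 ≤ b →
    (∀ j : ℕ, j ≤ n → 0 ≤ v + j * (v - u) + α * (j * (j + 1) / 2) - j * ρ) →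
    (∀ u' v' : ℝ, |(v' - u') - ((v - u) + n * α)| ≤ ρ →
      |v' - (v + n * (v - u) + α * (n * (n + 1) / 2))| ≤ n * ρ →
      ENNReal.ofReal b ≤ pathMass E (Ici 0) m u' v') →
    ENNReal.ofReal (p * b) ≤ pathMass E (Ici 0) (m + n) u v

lemma tubeBound_of_subsolution {E : ℝ → ℝ} (hE0 : ∀ x, 0 ≤ E x) (hE_int : Integrable E)
    {n : ℕ} {α ρ q : ℝ} (hq : 0 ≤ q) {ψ : ℕ → ℝ → ℝ}
    (hψ_meas : ∀ j, Measurable (ψ j)) (hψ_bdd : ∀ j y, |ψ j y| ≤ 1)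
    (hψ_supp : ∀ j y, 0 < ψ j y → j ≤ n → |y - j * α| ≤ ρ)
    (hψ_step : ∀ j y, 0 < ψ j y → j < n → q * ψ j y ≤ ∫ x, E x * ψ (j + 1) (y + x)) :
    TubeBound E n α ρ (q ^ n * ψ 0 0) := by
  intro m u v b hb hpos hend
  set y₀ := v - u with hy₀
  have key : ∀ k j : ℕ, j + k = n → ∀ u' v' : ℝ,
      |v' - (v + j * y₀ + α * (j * (j + 1) / 2))| ≤ j * ρ →
      ENNReal.ofReal (q ^ k * ψ j ((v' - u') - y₀) * b) ≤ pathMass E (Ici 0) (m + k) u' v' := by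
    intro k
    induction k with
    | zero =>
      intro j hj u' v' hv'
      obtain rfl : j = n := by omega
      rcases le_or_gt (ψ j ((v' - u') - y₀)) 0 with hle | hlt
      · rw [ENNReal.ofReal_of_nonpos]
        · exact zero_le
        · simpa using mul_nonpos_of_nonpos_of_nonneg hle hb
      · have h1 := hψ_supp j _ hlt le_rfl
        refine le_trans (ENNReal.ofReal_le_ofReal ?_) (hend u' v' (by
          rw [show v' - u' - (y₀ + j * α) = v' - u' - y₀ - j * α by ring]; exact h1) hv')
        have := (le_abs_self _).trans (hψ_bdd j ((v' - u') - y₀))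
        simpa using mul_le_mul_of_nonneg_right this hb
    | succ k ih =>
      intro j hj u' v' hv'
      rcases le_or_gt (ψ j ((v' - u') - y₀)) 0 with hle | hlt
      · rw [ENNReal.ofReal_of_nonpos]
        · exact zero_le
        · exact mul_nonpos_of_nonpos_of_nonneg
            (mul_nonpos_of_nonneg_of_nonpos (pow_nonneg hq _) hle) hb
      set y := (v' - u') - y₀ with hy
      set f : ℝ → ℝ := fun x => q ^ k * b * (E x * ψ (j + 1) (y + x)) with hf
      have hf_int : Integrable f := by
        refine Integrable.const_mul ?_ _
        refine hE_int.mul_bdd (c := 1) ?_ (ae_of_all _ fun x => ?_)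
        · exact ((hψ_meas (j + 1)).comp (measurable_const.add measurable_id)).aestronglyMeasurable
        · exact hψ_bdd _ _
      have hstep := hψ_step j y hlt (by omega)
      calc ENNReal.ofReal (q ^ (k + 1) * ψ j y * b)
          ≤ ENNReal.ofReal (∫ x, f x) := by
            refine ENNReal.ofReal_le_ofReal ?_
            rw [hf, integral_const_mul]
            calc q ^ (k + 1) * ψ j y * b = q ^ k * b * (q * ψ j y) := by ring
              _ ≤ _ := mul_le_mul_of_nonneg_left hstep (mul_nonneg (pow_nonneg hq _) hb)
        _ ≤ ∫⁻ x, ENNReal.ofReal (f x) := ofReal_integral_le_lintegral hf_int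
        _ = ∫⁻ w, ENNReal.ofReal (f (w + (u' - 2 * v'))) :=
            (lintegral_add_right_eq_self (fun x => ENNReal.ofReal (f x)) _).symm
        _ ≤ ∫⁻ w, (Ici (0 : ℝ)).indicator (fun w => ENNReal.ofReal (E (w + u' - 2 * v')) *
              pathMass E (Ici 0) (m + k) v' w) w := by
            refine lintegral_mono fun w => ?_
            have hyw : y + (w + (u' - 2 * v')) = (w - v') - y₀ := by rw [hy]; ring
            simp only [hf, hyw]
            rcases le_or_gt (ψ (j + 1) ((w - v') - y₀)) 0 with hle' | hlt'
            · rw [ENNReal.ofReal_of_nonpos]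
              · exact zero_le
              · exact mul_nonpos_of_nonneg_of_nonpos (mul_nonneg (pow_nonneg hq _) hb)
                  (mul_nonpos_of_nonneg_of_nonpos (hE0 _) hle')
            have hs := hψ_supp (j + 1) _ hlt' (by omega)
            have hw : |w - (v + (j + 1 : ℕ) * y₀ + α * ((j + 1 : ℕ) * ((j + 1 : ℕ) + 1) / 2))| ≤
                (j + 1 : ℕ) * ρ := by
              rw [abs_le] at hs hv' ⊢
              push_cast at hs ⊢
              constructor <;> linarith
            have hw0 : 0 ≤ w := by
              have := hpos (j + 1) (by omega)
              rw [abs_le] at hw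
              linarith
            rw [indicator_of_mem (by exact hw0)]
            calc _ = ENNReal.ofReal (E (w + u' - 2 * v') *
                    (q ^ k * ψ (j + 1) ((w - v') - y₀) * b)) := by
                  rw [← add_sub_assoc]; congr 1; ring
              _ = ENNReal.ofReal (E (w + u' - 2 * v')) *
                    ENNReal.ofReal (q ^ k * ψ (j + 1) ((w - v') - y₀) * b) :=
                  ENNReal.ofReal_mul (hE0 _)
              _ ≤ _ := mul_le_mul_right (ih (j + 1) (by omega) v' w hw) _
        _ = pathMass E (Ici 0) (m + (k + 1)) u' v' := by
            rw [lintegral_indicator measurableSet_Ici]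
            rfl
  have := key n 0 (by omega) u v (by simp)
  simpa [hy₀] using this

lemma exists_tubeBound_of_pos {E : ℝ → ℝ} (hE0 : ∀ x, 0 ≤ E x) (hE_int : Integrable E)
    {r d : ℝ} (hr : 0 < r) (hd : 0 < d) (hE : ∀ x, |x| ≤ r → d ≤ E x)
    (n : ℕ) {ρ : ℝ} (hρ : 0 < ρ) :
    ∃ p, 0 < p ∧ ∀ α, |α| ≤ r / 2 → TubeBound E n α ρ p := by
  set s := min (ρ / (n + 1)) (r / 2) with hs
  have hs0 : 0 < s := by positivity
  have hsr : s ≤ r / 2 := min_le_right _ _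
  have hsn : s * (n + 1) ≤ ρ := by
    rw [← le_div_iff₀ (by positivity)]; exact min_le_left _ _
  refine ⟨(2 * s * d) ^ n, by positivity, fun α hα => ?_⟩
  let ψ : ℕ → ℝ → ℝ := fun j => (Icc (j * α - j * s) (j * α + j * s)).indicator 1
  have hmem : ∀ j y, 0 < ψ j y → y ∈ Icc (j * α - j * s) (j * α + j * s) := by
    intro j y h
    by_contra hc
    simp [ψ, indicator_of_notMem hc] at h
  have hψ : TubeBound E n α ρ ((2 * s * d) ^ n * ψ 0 0) := by
    refine tubeBound_of_subsolution hE0 hE_int (by positivity)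
      (fun j => measurable_one.indicator measurableSet_Icc) (fun j y => ?_) (fun j y h hj => ?_)
      (fun j y h hj => ?_)
    · by_cases h : y ∈ Icc (j * α - j * s) (j * α + j * s)
      · simp [ψ, indicator_of_mem h]
      · simp [ψ, indicator_of_notMem h]
    · have h1 := hmem j y h
      have h2 : (j : ℝ) * s ≤ ρ := by
        have : (j : ℝ) ≤ n + 1 := by exact_mod_cast (by omega : j ≤ n + 1)
        nlinarith
      rw [abs_le]
      constructor <;> linarith [h1.1, h1.2]
    · have h1 := hmem j y h
      have hone : ψ j y = 1 := by simp [ψ, indicator_of_mem h1]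
      rw [hone, mul_one]
      have hle : ∀ x, (Icc (α - s) (α + s)).indicator (fun _ => d) x ≤ E x * ψ (j + 1) (y + x) := by
        intro x
        by_cases hx : x ∈ Icc (α - s) (α + s)
        · have hyx : y + x ∈ Icc ((j + 1 : ℕ) * α - (j + 1 : ℕ) * s)
              ((j + 1 : ℕ) * α + (j + 1 : ℕ) * s) := by
            push_cast
            constructor <;> linarith [h1.1, h1.2, hx.1, hx.2]
          rw [indicator_of_mem hx]
          simp only [ψ, indicator_of_mem hyx, Pi.one_apply, mul_one]
          apply hE
          rw [abs_le] at hα ⊢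
          constructor <;> linarith [hx.1, hx.2, hα.1, hα.2]
        · rw [indicator_of_notMem hx]
          refine mul_nonneg (hE0 _) (indicator_nonneg (fun _ _ => zero_le_one) _)
      calc 2 * s * d = ∫ x, (Icc (α - s) (α + s)).indicator (fun _ => d) x := by
            rw [integral_indicator measurableSet_Icc]
            rw [setIntegral_const, Real.volume_real_Icc_of_le (by linarith), smul_eq_mul]
            ring
        _ ≤ _ := by
            refine integral_mono ?_ ?_ hle
            · rw [integrable_indicator_iff measurableSet_Icc]
              exact integrableOn_const (by simp)
            · refine hE_int.mul_bdd (c := 1) ?_ (ae_of_all _ fun x => ?_)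
              · exact ((measurable_one.indicator measurableSet_Icc).comp
                  (measurable_const.add measurable_id)).aestronglyMeasurable
              · refine (norm_indicator_le_norm_self _ _).trans ?_
                simp
  have h00 : ψ 0 0 = 1 := by simp [ψ]
  simpa [h00] using hψ

lemma pathMass_succ_ge {E : ℝ → ℝ} {d b κ τ u v : ℝ} {m : ℕ} (hd : 0 ≤ d) (hb : 0 ≤ b)
    (hκ : 0 ≤ κ) (hE : ∀ w ∈ Icc κ (κ + τ), d ≤ E (w + u - 2 * v))
    (h : ∀ w ∈ Icc κ (κ + τ), ENNReal.ofReal b ≤ pathMass E (Ici 0) m v w) :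
    ENNReal.ofReal (d * b * τ) ≤ pathMass E (Ici 0) (m + 1) u v := by
  calc ENNReal.ofReal (d * b * τ)
      = ∫⁻ w in Icc κ (κ + τ), ENNReal.ofReal (d * b) := by
        rw [setLIntegral_const, Real.volume_Icc, add_sub_cancel_left,
          ENNReal.ofReal_mul (by positivity)]
    _ ≤ ∫⁻ w in Icc κ (κ + τ),
          ENNReal.ofReal (E (w + u - 2 * v)) * pathMass E (Ici 0) m v w := by
        refine setLIntegral_mono' measurableSet_Icc fun w hw => ?_
        rw [ENNReal.ofReal_mul hd]
        exact mul_le_mul' (ENNReal.ofReal_le_ofReal (hE w hw)) (h w hw)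
    _ ≤ _ := lintegral_mono_set fun w hw => hκ.trans hw.1

lemma exists_pathMass_lower_bound {E : ℝ → ℝ} {r d : ℝ} (hr : 0 < r) (hd : 0 < d)
    (hE : ∀ x, |x| ≤ r → d ≤ E x) (m : ℕ) :
    ∃ c, 0 < c ∧ ∀ u v, u ∈ Icc 0 (r / 8) → v ∈ Icc 0 (r / 8) →
      ENNReal.ofReal c ≤ pathMass E (Ici 0) m u v := by
  have hbd : ∀ u v w, u ∈ Icc 0 (r / 8) → v ∈ Icc 0 (r / 8) → w ∈ Icc 0 (r / 8) →
      d ≤ E (w + u - 2 * v) := fun u v w hu hv hw => hE _ (by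
    rw [abs_le]; constructor <;> linarith [hu.1, hu.2, hv.1, hv.2, hw.1, hw.2])
  induction m with
  | zero =>
    refine ⟨d * d, by positivity, fun u v hu hv => ENNReal.ofReal_le_ofReal ?_⟩
    have h1 := hbd u v 0 hu hv ⟨le_rfl, by positivity⟩
    have h2 := hbd v 0 0 hv ⟨le_rfl, by positivity⟩ ⟨le_rfl, by positivity⟩
    simp only [zero_add, mul_zero, sub_zero] at h1 h2
    exact mul_le_mul h1 h2 hd.le (hd.le.trans h1)
  | succ m ih =>
    obtain ⟨c, hc, h⟩ := ih
    refine ⟨d * c * (r / 8), by positivity, fun u v hu hv => ?_⟩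
    refine pathMass_succ_ge hd.le hc.le le_rfl (fun w hw => ?_) (fun w hw => ?_)
    · exact hbd u v w hu hv (by simpa using hw)
    · exact h v w hv (by simpa using hw)

set_option maxHeartbeats 1000000 in
/-- Two consecutive tubes steer the path from height `v` and slope `v - u` to height close to `Z`
and slope close to zero. -/
lemma pathMass_ge_of_tubeBound {E : ℝ → ℝ} {n : ℕ} (hn : 1 ≤ n) {ρ p B : ℝ} (hρ : 0 ≤ ρ)
    (hp : 0 ≤ p) (hT : ∀ α, |α| ≤ B → TubeBound E n α ρ p) {m : ℕ} {u v Z b : ℝ} (hb : 0 ≤ b)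
    (hv : 9 * n * |v - u| + 3 * n * ρ ≤ v) (hZ : 9 * n * |v - u| + 3 * n * ρ ≤ Z)
    (hB : |Z - v| / n ^ 2 + 3 * |v - u| / n ≤ B)
    (hend : ∀ u' v', |v' - u'| ≤ 2 * ρ → |v' - Z| ≤ 3 * n * ρ →
      ENNReal.ofReal b ≤ pathMass E (Ici 0) m u' v') :
    ENNReal.ofReal (p ^ 2 * b) ≤ pathMass E (Ici 0) (m + 2 * n) u v := by
  have hN : (1 : ℝ) ≤ n := by exact_mod_cast hn
  set N : ℝ := (n : ℝ) with hNdef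
  have hN0 : N ≠ 0 := by positivity
  obtain ⟨g, hg⟩ : ∃ g, v - u = g * N := ⟨(v - u) / N, by field_simp⟩
  obtain ⟨β, hβ⟩ : ∃ β, Z = v + β * N ^ 2 := ⟨(Z - v) / N ^ 2, by field_simp; ring⟩
  obtain ⟨κ, hκ⟩ : ∃ κ, κ * N = -(3 / 2) * N + 1 / 2 :=
    ⟨(-(3 / 2) * N + 1 / 2) / N, by field_simp⟩
  have hκ1 : -(3 / 2) ≤ κ := by nlinarith
  have hκ2 : κ ≤ -1 := by nlinarith
  have hgabs : |v - u| = |g| * N := by rw [hg, abs_mul, abs_of_pos (by linarith : 0 < N)]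
  have hβabs : |Z - v| / N ^ 2 = |β| := by
    rw [hβ, add_sub_cancel_left, abs_mul, abs_of_pos (by positivity : 0 < N ^ 2)]
    field_simp
  have hB' : |β| + 3 * |g| ≤ B := by
    rw [hβabs, hgabs] at hB
    rwa [show 3 * (|g| * N) / N = 3 * |g| by field_simp] at hB
  rw [hgabs] at hv hZ
  have hconv : ∀ t, 0 ≤ t → t ≤ N ^ 2 → 9 * N ^ 2 * |g| + 3 * N * ρ ≤ v + β * t := by
    intro t ht0 ht1
    rcases le_total 0 β with h | h
    · nlinarith [mul_nonneg h ht0]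
    · nlinarith [mul_le_mul_of_nonpos_left ht1 h]
  have hgbound : ∀ c, |c| ≤ 9 * N ^ 2 → -(9 * N ^ 2 * |g|) ≤ g * c := by
    intro c hc
    have : |g * c| ≤ 9 * N ^ 2 * |g| := by
      rw [abs_mul, mul_comm]; exact mul_le_mul_of_nonneg_right hc (abs_nonneg _)
    exact (abs_le.1 this).1
  have hα₁ : |β + κ * g| ≤ B := by
    have : |κ * g| ≤ 3 * |g| := by
      rw [abs_mul]
      exact mul_le_mul_of_nonneg_right (abs_le.2 ⟨by linarith, by linarith⟩) (abs_nonneg _)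
    linarith [abs_add_le β (κ * g)]
  have hα₂ : |-β - (1 + κ) * g| ≤ B := by
    have : |(1 + κ) * g| ≤ 3 * |g| := by
      rw [abs_mul]
      exact mul_le_mul_of_nonneg_right (abs_le.2 ⟨by linarith, by linarith⟩) (abs_nonneg _)
    have h2 := abs_sub (-β) ((1 + κ) * g)
    rw [abs_neg] at h2
    linarith
  have hJ : ∀ j : ℕ, j ≤ n → (0 : ℝ) ≤ j ∧ (j : ℝ) ≤ N ∧
      0 ≤ (j : ℝ) * (j + 1) / 2 ∧ (j : ℝ) * (j + 1) / 2 ≤ N ^ 2 ∧ (j : ℝ) * N ≤ N ^ 2 := by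
    intro j hj
    have h1 : (0 : ℝ) ≤ j := by positivity
    have h2 : (j : ℝ) ≤ N := Nat.cast_le.2 hj
    exact ⟨h1, h2, by positivity, by nlinarith, by nlinarith⟩
  have hκt : ∀ t, 0 ≤ t → t ≤ N ^ 2 → -(3 / 2) * N ^ 2 ≤ κ * t ∧ κ * t ≤ -t := by
    intro t ht0 ht1
    constructor <;> nlinarith
  rw [show m + 2 * n = (m + n) + n by ring, pow_two, mul_assoc]
  refine hT _ hα₁ (m + n) u v (p * b) (by positivity) ?_ ?_
  · intro j hj
    obtain ⟨hj0, hjN, hJ0, hJ1, hj2⟩ := hJ j hj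
    have h1 := hconv _ hJ0 hJ1
    have hκJ := hκt _ hJ0 hJ1
    have hjN0 : 0 ≤ (j : ℝ) * N := by positivity
    have h2 := hgbound (j * N + κ * (j * (j + 1) / 2))
      (abs_le.2 ⟨by linarith [hκJ.1], by linarith [hκJ.2]⟩)
    have h3 : j * ρ ≤ N * ρ := mul_le_mul_of_nonneg_right hjN hρ
    have h4 : 0 ≤ N * ρ := by positivity
    rw [hg]
    linarith
  · intro u₁ v₁ hy₁ hv₁
    obtain ⟨-, -, hJN0, hJN1, -⟩ := hJ n le_rfl
    rw [← hNdef] at hJN0 hJN1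
    rw [hg] at hy₁ hv₁
    rw [abs_le] at hy₁ hv₁
    refine hT _ hα₂ m u₁ v₁ b hb ?_ ?_
    · intro j hj
      obtain ⟨hj0, hjN, hJ0, hJ1, hj2⟩ := hJ j hj
      have hprod : 0 ≤ (N - j) * (N - j - 1) := by
        rcases hj.eq_or_lt with rfl | hlt
        · simp [hNdef]
        · have : (j : ℝ) + 1 ≤ N := by rw [hNdef]; exact_mod_cast hlt
          exact mul_nonneg (by linarith) (by linarith)
      have hmono : (j : ℝ) * (j + 1) / 2 ≤ N * (N + 1) / 2 := by nlinarith
      have hjN0 : 0 ≤ (j : ℝ) * N := by positivity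
      have h1 := hconv (N * (N + 1) / 2 + j * N - j * (j + 1) / 2) (by linarith)
        (by linarith)
      have hκJ := hκt _ hJ0 hJ1
      have hκJN := hκt _ hJN0 hJN1
      have hκj := hκt _ hjN0 hj2
      have h2 := hgbound (N ^ 2 + κ * (N * (N + 1) / 2) + j * N + j * N * κ
        - (1 + κ) * (j * (j + 1) / 2)) (abs_le.2
        ⟨by linarith [hκJ.2, hκJN.1, hκj.1], by linarith [hκJ.1, hκJN.2, hκj.2]⟩)
      have h3 : j * ρ ≤ N * ρ := mul_le_mul_of_nonneg_right hjN hρ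
      have h4 : j * (g * N + N * (β + κ * g) - ρ) ≤ j * (v₁ - u₁) :=
        mul_le_mul_of_nonneg_left (by linarith [hy₁.1]) hj0
      linarith [hv₁.1]
    · intro u₂ v₂ hy₂ hv₂
      rw [← hNdef] at hy₂ hv₂
      rw [abs_le] at hy₂ hv₂
      refine hend u₂ v₂ (abs_le.2 ⟨by linarith [hy₁.1, hy₂.1], by linarith [hy₁.2, hy₂.2]⟩) ?_
      have hzero : g * N * (κ * N) = g * N * (-(3 / 2) * N + 1 / 2) := by rw [hκ]
      have h4 : N * (g * N + N * (β + κ * g) - ρ) ≤ N * (v₁ - u₁) :=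
        mul_le_mul_of_nonneg_left (by linarith [hy₁.1]) (by linarith)
      have h5 : N * (v₁ - u₁) ≤ N * (g * N + N * (β + κ * g) + ρ) :=
        mul_le_mul_of_nonneg_left (by linarith [hy₁.2]) (by linarith)
      rw [hβ]
      exact abs_le.2 ⟨by linarith [hv₁.1, hv₂.1], by linarith [hv₁.2, hv₂.2]⟩

lemma TubeBound.mono {E : ℝ → ℝ} {n : ℕ} {α ρ p q : ℝ} (h : TubeBound E n α ρ q) (hpq : p ≤ q) :
    TubeBound E n α ρ p := fun m u v b hb hpos hend =>
  (ENNReal.ofReal_le_ofReal (mul_le_mul_of_nonneg_right hpq hb)).trans (h m u v b hb hpos hend)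

lemma gaussian_taylor_lower_bound {M ξ h δ : ℝ} (hM : 1 ≤ M) (hξ : |ξ| ≤ 1) (hδ : 0 < δ)
    (hδM : 3 * M * δ ≤ 1) :
    Real.exp (-M * ξ ^ 2) * (1 - 2 * M * ξ * h + (2 * M ^ 2 * ξ ^ 2 - M) * h ^ 2)
      - 29 * M ^ 3 * δ * h ^ 2
      - (1 / δ ^ 2 + 2 * M / δ + 2 * M ^ 2) * (if δ < |h| then h ^ 2 else 0)
      ≤ Real.exp (-M * (ξ + h) ^ 2) := by
  have hG1 : Real.exp (-M * ξ ^ 2) ≤ 1 := by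
    rw [Real.exp_le_one_iff]; nlinarith [sq_nonneg ξ]
  have hG0 := Real.exp_pos (-M * ξ ^ 2)
  have hξ2 : ξ ^ 2 ≤ 1 := by rw [← sq_abs]; nlinarith [abs_nonneg ξ]
  have hh := abs_nonneg h
  have hξh : |ξ * h| ≤ |h| := by rw [abs_mul]; nlinarith
  have hξh' := abs_le.1 hξh
  rw [← sq_abs h]
  split_ifs with hlt
  · have h1 : 1 - 2 * M * ξ * h + (2 * M ^ 2 * ξ ^ 2 - M) * |h| ^ 2 ≤
        (1 / δ ^ 2 + 2 * M / δ + 2 * M ^ 2) * |h| ^ 2 := by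
      obtain ⟨k, hk⟩ : ∃ k, |h| = k * δ := ⟨|h| / δ, by field_simp⟩
      have hk1 : 1 ≤ k := by
        by_contra hc
        nlinarith
      have e1 : (1 / δ ^ 2 + 2 * M / δ + 2 * M ^ 2) * |h| ^ 2 =
          k ^ 2 + 2 * M * k * |h| + 2 * M ^ 2 * |h| ^ 2 := by
        rw [hk]; field_simp
      rw [e1]
      have e2 : |h| ≤ k * |h| := le_mul_of_one_le_left hh hk1
      have e3 : ξ ^ 2 * |h| ^ 2 ≤ |h| ^ 2 := mul_le_of_le_one_left (by positivity) hξ2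
      have e4 : M * (-(ξ * h)) ≤ M * (k * |h|) :=
        mul_le_mul_of_nonneg_left (by linarith) (by linarith)
      have e5 : M ^ 2 * (ξ ^ 2 * |h| ^ 2) ≤ M ^ 2 * |h| ^ 2 :=
        mul_le_mul_of_nonneg_left e3 (by positivity)
      have e6 : 0 ≤ M * |h| ^ 2 := by positivity
      nlinarith
    have h2 : 0 ≤ (1 / δ ^ 2 + 2 * M / δ + 2 * M ^ 2) * |h| ^ 2 := by positivity
    have h3 : 0 ≤ 29 * M ^ 3 * δ * |h| ^ 2 := by positivity
    have h4 := mul_le_mul_of_nonneg_left h1 hG0.le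
    have h5 := mul_le_of_le_one_left h2 hG1
    linarith [Real.exp_pos (-M * (ξ + h) ^ 2)]
  · have hle : |h| ≤ δ := not_lt.1 hlt
    set s := -(2 * M * (ξ * h)) - M * |h| ^ 2 with hs
    have hh1 : |h| ≤ 1 := by nlinarith
    have hsq : |h| ^ 2 ≤ |h| := by nlinarith
    have hsabs : |s| ≤ 3 * M * |h| := by
      rw [abs_le]
      constructor <;> nlinarith
    have hs1 : |s| ≤ 1 := hsabs.trans (by nlinarith)
    have hexp := abs_le.1 (Real.exp_bound hs1 (n := 3) (by norm_num))
    simp only [Finset.sum_range_succ, Finset.sum_range_zero] at hexp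
    norm_num [Nat.factorial] at hexp
    have hs3 : |s| ^ 3 ≤ 27 * M ^ 3 * |h| ^ 3 := by
      calc |s| ^ 3 ≤ (3 * M * |h|) ^ 3 := by gcongr
        _ = _ := by ring
    have hss : 4 * M ^ 2 * ξ ^ 2 * |h| ^ 2 - 4 * M ^ 2 * |h| ^ 3 ≤ s ^ 2 := by
      have e1 : s ^ 2 = 4 * M ^ 2 * ξ ^ 2 * |h| ^ 2 + 4 * M ^ 2 * ((ξ * h) * |h| ^ 2)
          + (M * |h| ^ 2) ^ 2 := by
        rw [hs, sq_abs]; ring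
      have e2 : -(|h| ^ 3) ≤ (ξ * h) * |h| ^ 2 := by nlinarith [sq_nonneg |h|]
      have e3 := mul_le_mul_of_nonneg_left e2 (by positivity : 0 ≤ 4 * M ^ 2)
      nlinarith [sq_nonneg (M * |h| ^ 2)]
    have hMM : M ^ 2 * |h| ^ 3 ≤ M ^ 3 * |h| ^ 3 := by
      refine mul_le_mul_of_nonneg_right ?_ (by positivity)
      nlinarith [sq_nonneg M]
    have hcube : M ^ 3 * |h| ^ 3 ≤ M ^ 3 * δ * |h| ^ 2 := by
      rw [show M ^ 3 * |h| ^ 3 = M ^ 3 * |h| * |h| ^ 2 by ring]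
      gcongr
    have hpos3 : 0 ≤ M ^ 3 * |h| ^ 3 := by positivity
    have hlow : 1 - 2 * M * ξ * h + (2 * M ^ 2 * ξ ^ 2 - M) * |h| ^ 2
        - 29 * M ^ 3 * δ * |h| ^ 2 ≤ Real.exp s := by
      have e1 : s = -(2 * M * (ξ * h)) - M * |h| ^ 2 := hs
      nlinarith [hexp.1]
    have hprod : Real.exp (-M * (ξ + h) ^ 2) = Real.exp (-M * ξ ^ 2) * Real.exp s := by
      rw [← Real.exp_add, hs, sq_abs]; ring_nf
    rw [hprod]
    have h1 := mul_le_mul_of_nonneg_left hlow hG0.le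
    have h3 : 0 ≤ 29 * M ^ 3 * δ * |h| ^ 2 := by positivity
    have h5 := mul_le_of_le_one_left h3 hG1
    linarith

/-- The generator of the rescaled slope walk acting on `exp (-M ξ²) - exp (-M)`. -/
lemma gaussian_generator_bound {M a w₀ w₁ C ξ s w err : ℝ} (hM : 2 ≤ M) (ha : 0 ≤ a)
    (hMa : 2 * M * a + 1 ≤ M ^ 2 * w₀) (hw₀ : 0 ≤ w₀)
    (hC0 : 0 ≤ C)
    (hC : 2 * M * a + M * w₁ + 1 ≤ C * (Real.exp (-(3 / 4) * M) - Real.exp (-M)))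
    (hξ : |ξ| ≤ 1) (hs : |s| ≤ a) (hw : w₀ ≤ w) (hw' : w ≤ w₁) (herr : err ≤ Real.exp (-M)) :
    0 ≤ C * (Real.exp (-M * ξ ^ 2) - Real.exp (-M))
      + Real.exp (-M * ξ ^ 2) * (2 * M * ξ * s + (2 * M ^ 2 * ξ ^ 2 - M) * w) - err := by
  have hξ2 : ξ ^ 2 ≤ 1 := by rw [← sq_abs]; nlinarith [abs_nonneg ξ]
  have hG1 : Real.exp (-M * ξ ^ 2) ≤ 1 := by
    rw [Real.exp_le_one_iff]; nlinarith [sq_nonneg ξ]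
  have hG0 := Real.exp_pos (-M * ξ ^ 2)
  have hGe : Real.exp (-M) ≤ Real.exp (-M * ξ ^ 2) := Real.exp_le_exp.2 (by nlinarith)
  have hξs : |ξ * s| ≤ a := by
    rw [abs_mul]
    exact (mul_le_of_le_one_left (abs_nonneg s) hξ).trans hs
  have hξs' := abs_le.1 hξs
  have hMs : -(2 * M * a) ≤ 2 * M * ξ * s := by nlinarith
  rcases le_or_gt (3 / 4) (ξ ^ 2) with hcase | hcase
  · have h1 : M ^ 2 ≤ 2 * M ^ 2 * ξ ^ 2 - M := by nlinarith [sq_nonneg M]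
    have h2 : M ^ 2 * w₀ ≤ (2 * M ^ 2 * ξ ^ 2 - M) * w := by
      exact mul_le_mul h1 hw hw₀ ((sq_nonneg M).trans h1)
    have h3 : Real.exp (-M * ξ ^ 2) * 1 ≤
        Real.exp (-M * ξ ^ 2) * (2 * M * ξ * s + (2 * M ^ 2 * ξ ^ 2 - M) * w) :=
      mul_le_mul_of_nonneg_left (by linarith) hG0.le
    have h4 : 0 ≤ C * (Real.exp (-M * ξ ^ 2) - Real.exp (-M)) :=
      mul_nonneg hC0 (by linarith)
    linarith
  · have h1 : Real.exp (-(3 / 4) * M) ≤ Real.exp (-M * ξ ^ 2) :=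
      Real.exp_le_exp.2 (by nlinarith)
    have h2 : C * (Real.exp (-(3 / 4) * M) - Real.exp (-M)) ≤
        C * (Real.exp (-M * ξ ^ 2) - Real.exp (-M)) :=
      mul_le_mul_of_nonneg_left (by linarith) hC0
    have hw0 : 0 ≤ w := hw₀.trans hw
    have h3 : -(M * w₁) ≤ (2 * M ^ 2 * ξ ^ 2 - M) * w := by
      have : 0 ≤ 2 * M ^ 2 * ξ ^ 2 * w := by positivity
      nlinarith
    have h4 : -(2 * M * a + M * w₁) ≤ 2 * M * ξ * s + (2 * M ^ 2 * ξ ^ 2 - M) * w := by linarith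
    have h6 : 0 ≤ 2 * M * a + M * w₁ := by
      have : 0 ≤ w₁ := hw0.trans hw'
      positivity
    have h5 : -(2 * M * a + M * w₁) ≤
        Real.exp (-M * ξ ^ 2) * (2 * M * ξ * s + (2 * M ^ 2 * ξ ^ 2 - M) * w) := by
      have e1 := mul_le_mul_of_nonneg_left h4 hG0.le
      have e2 := mul_le_of_le_one_left h6 hG1
      linarith
    have h7 : Real.exp (-M) ≤ 1 := Real.exp_le_one_iff.2 (by linarith)
    linarith

lemma exp_neg_two_mul_le_pow {C : ℝ} (hC : 0 ≤ C) {n : ℕ} (hn : 2 * C ≤ n) (hn0 : 0 < n) :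
    Real.exp (-(2 * C)) ≤ (1 - C / n) ^ n := by
  have hn' : (0 : ℝ) < n := by exact_mod_cast hn0
  obtain ⟨x, hx⟩ : ∃ x, C = x * n := ⟨C / n, by field_simp⟩
  have hx0 : 0 ≤ x := by
    by_contra hc
    nlinarith
  have hx1 : x ≤ 1 / 2 := by
    by_contra hc
    nlinarith
  have h1 : Real.exp (-(2 * x)) ≤ 1 - x := by
    rw [Real.exp_neg, inv_le_iff_one_le_mul₀ (Real.exp_pos _)]
    have := Real.add_one_le_exp (2 * x)
    nlinarith
  calc Real.exp (-(2 * C)) = Real.exp (-(2 * x)) ^ n := by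
        rw [← Real.exp_nat_mul, hx]; ring_nf
    _ ≤ (1 - x) ^ n := by gcongr
    _ = _ := by rw [hx]; field_simp

lemma tendsto_truncated_second_moment {E : ℝ → ℝ} (hE0 : ∀ x, 0 ≤ E x) (hE_int : Integrable E)
    (hE_mom2 : Integrable fun x => x ^ 2 * E x) (A : ℝ) :
    Tendsto (fun T : ℝ => ∫ x, E x * (if T < |x| + A then (|x| + A) ^ 2 else 0)) atTop (𝓝 0) := by
  have hdom : Integrable fun x => 2 * (x ^ 2 * E x) + 2 * A ^ 2 * E x :=
    (hE_mom2.const_mul 2).add (hE_int.const_mul _)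
  have := tendsto_integral_filter_of_dominated_convergence (μ := volume) (l := (atTop : Filter ℝ))
    (F := fun T x => E x * (if T < |x| + A then (|x| + A) ^ 2 else 0)) (f := fun _ => 0)
    (fun x => 2 * (x ^ 2 * E x) + 2 * A ^ 2 * E x) ?_ ?_ hdom ?_
  · simpa using this
  · refine Eventually.of_forall fun T => hE_int.aestronglyMeasurable.mul ?_
    refine (Measurable.ite ?_ (by fun_prop) measurable_const).aestronglyMeasurable
    exact measurableSet_lt measurable_const (by fun_prop)
  · refine Eventually.of_forall fun T => ae_of_all _ fun x => ?_
    have h1 : (if T < |x| + A then (|x| + A) ^ 2 else 0) ≤ 2 * x ^ 2 + 2 * A ^ 2 := by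
      rw [← sq_abs x]
      split_ifs
      · nlinarith [sq_nonneg (|x| - A)]
      · positivity
    have h0 : 0 ≤ (if T < |x| + A then (|x| + A) ^ 2 else 0) := by split_ifs <;> positivity
    rw [Real.norm_of_nonneg (mul_nonneg (hE0 x) h0)]
    nlinarith [mul_le_mul_of_nonneg_left h1 (hE0 x)]
  · refine ae_of_all _ fun x => ?_
    refine tendsto_const_nhds.congr' ?_
    filter_upwards [eventually_ge_atTop (|x| + A)] with T hT
    simp [not_lt.2 hT]

lemma gaussian_step_lower_bound {E : ℝ → ℝ} {σ : ℝ} (hE0 : ∀ x, 0 ≤ E x) (hE_int : Integrable E)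
    (hE_mass : ∫ x, E x = 1) (hE_mom1 : Integrable fun x => x * E x)
    (hE_mean : ∫ x, x * E x = 0) (hE_mom2 : Integrable fun x => x ^ 2 * E x)
    (hE_var : ∫ x, x ^ 2 * E x = σ ^ 2) {A α ρ M ξ δ : ℝ} (hα : |α| ≤ A) (hρ : 0 < ρ)
    (hM : 1 ≤ M) (hξ : |ξ| ≤ 1) (hδ : 0 < δ) (hδM : 3 * M * δ ≤ 1) :
    Real.exp (-M * ξ ^ 2) * (1 + 2 * M * ξ * (α / ρ) +
        (2 * M ^ 2 * ξ ^ 2 - M) * ((σ ^ 2 + α ^ 2) / ρ ^ 2))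
      - 29 * M ^ 3 * δ * ((σ ^ 2 + α ^ 2) / ρ ^ 2)
      - (1 / δ ^ 2 + 2 * M / δ + 2 * M ^ 2) / ρ ^ 2 *
        ∫ x, E x * (if δ * ρ < |x| + A then (|x| + A) ^ 2 else 0)
      ≤ ∫ x, E x * Real.exp (-M * (ξ + (x - α) / ρ) ^ 2) := by
  set G := Real.exp (-M * ξ ^ 2) with hG
  set K := 1 / δ ^ 2 + 2 * M / δ + 2 * M ^ 2 with hK
  have hK0 : 0 ≤ K := by positivity
  set F := (G * (2 * M ^ 2 * ξ ^ 2 - M) - 29 * M ^ 3 * δ) / ρ ^ 2 with hF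
  set tail : ℝ → ℝ := fun x => if δ * ρ < |x| + A then (|x| + A) ^ 2 else 0 with htail
  have hA0 : 0 ≤ A := (abs_nonneg α).trans hα
  have htail_meas : Measurable tail :=
    Measurable.ite (measurableSet_lt measurable_const (by fun_prop)) (by fun_prop)
      measurable_const
  have htail_int : Integrable fun x => E x * tail x := by
    refine Integrable.mono' ((hE_mom2.const_mul 2).add (hE_int.const_mul (2 * A ^ 2)))
      (hE_int.aestronglyMeasurable.mul htail_meas.aestronglyMeasurable) (ae_of_all _ fun x => ?_)
    have h1 : tail x ≤ 2 * x ^ 2 + 2 * A ^ 2 := by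
      rw [← sq_abs x]
      simp only [htail]
      split_ifs
      · nlinarith [sq_nonneg (|x| - A)]
      · positivity
    have h0 : 0 ≤ tail x := by simp only [htail]; split_ifs <;> positivity
    rw [Real.norm_of_nonneg (mul_nonneg (hE0 x) h0)]
    simp only [Pi.add_apply]
    nlinarith [mul_le_mul_of_nonneg_left h1 (hE0 x)]
  set f : ℝ → ℝ := fun x => (G * (1 + 2 * M * ξ * (α / ρ)) + F * α ^ 2) * E x
    + (-(2 * M * ξ * G / ρ) - 2 * α * F) * (x * E x) + F * (x ^ 2 * E x)
    - K / ρ ^ 2 * (E x * tail x) with hf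
  have i0 := hE_int.const_mul (G * (1 + 2 * M * ξ * (α / ρ)) + F * α ^ 2)
  have i1 := hE_mom1.const_mul (-(2 * M * ξ * G / ρ) - 2 * α * F)
  have i2 := hE_mom2.const_mul F
  have i3 := htail_int.const_mul (K / ρ ^ 2)
  have hf_int : Integrable f := ((i0.add i1).add i2).sub i3
  have hfval : ∫ x, f x = (G * (1 + 2 * M * ξ * (α / ρ)) + F * α ^ 2) + F * σ ^ 2
      - K / ρ ^ 2 * ∫ x, E x * tail x := by
    have e1 := integral_sub ((i0.add i1).add i2) i3
    have e2 := integral_add (i0.add i1) i2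
    have e3 := integral_add i0 i1
    simp only [Pi.add_apply] at e1 e2
    rw [hf, e1, e2, e3]
    simp only [integral_const_mul, hE_mass, hE_mean, hE_var]
    ring
  have hrhs_int : Integrable fun x => E x * Real.exp (-M * (ξ + (x - α) / ρ) ^ 2) := by
    refine hE_int.mul_bdd (c := 1) ?_ (ae_of_all _ fun x => ?_)
    · exact (by fun_prop : Continuous fun x : ℝ =>
        Real.exp (-M * (ξ + (x - α) / ρ) ^ 2)).aestronglyMeasurable
    · rw [Real.norm_of_nonneg (Real.exp_pos _).le, Real.exp_le_one_iff]
      nlinarith [sq_nonneg (ξ + (x - α) / ρ)]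
  calc _ = ∫ x, f x := by
        rw [hfval, hF]
        change _ - K / ρ ^ 2 * (∫ x, E x * tail x) = _
        field_simp
        ring
    _ ≤ _ := by
        refine integral_mono hf_int hrhs_int fun x => ?_
        have ht := gaussian_taylor_lower_bound (h := (x - α) / ρ) hM hξ hδ hδM
        have htl : (if δ < |(x - α) / ρ| then ((x - α) / ρ) ^ 2 else 0) ≤ tail x / ρ ^ 2 := by
          have hx : |x - α| ≤ |x| + A := (abs_sub x α).trans (by linarith)
          have hx2 : (x - α) ^ 2 ≤ (|x| + A) ^ 2 := by
            rw [← sq_abs (x - α)]; gcongr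
          simp only [htail]
          by_cases hc : δ < |(x - α) / ρ|
          · have hc' : δ * ρ < |x - α| := by
              rwa [abs_div, abs_of_pos hρ, lt_div_iff₀ hρ] at hc
            rw [if_pos hc, if_pos (hc'.trans_le hx), div_pow]
            gcongr
          · rw [if_neg hc]
            split_ifs <;> positivity
        have ht' : G * (1 - 2 * M * ξ * ((x - α) / ρ)
            + (2 * M ^ 2 * ξ ^ 2 - M) * ((x - α) / ρ) ^ 2)
            - 29 * M ^ 3 * δ * ((x - α) / ρ) ^ 2 - K * (tail x / ρ ^ 2) ≤
            Real.exp (-M * (ξ + (x - α) / ρ) ^ 2) := by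
          have := mul_le_mul_of_nonneg_left htl hK0
          linarith
        calc f x = E x * (G * (1 - 2 * M * ξ * ((x - α) / ρ)
            + (2 * M ^ 2 * ξ ^ 2 - M) * ((x - α) / ρ) ^ 2)
            - 29 * M ^ 3 * δ * ((x - α) / ρ) ^ 2 - K * (tail x / ρ ^ 2)) := by
              simp only [hf, hF]
              field_simp
              ring
          _ ≤ _ := mul_le_mul_of_nonneg_left ht' (hE0 x)

set_option maxHeartbeats 1000000 in
/-- On the diffusive scale the slope follows a line for `n` steps with probability bounded below
uniformly in `n`. -/
lemma exists_tubeBound_diffusive {E : ℝ → ℝ} {σ : ℝ} (hE0 : ∀ x, 0 ≤ E x)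
    (hE_int : Integrable E)
    (hE_mass : ∫ x, E x = 1) (hE_mom1 : Integrable fun x => x * E x)
    (hE_mean : ∫ x, x * E x = 0) (hE_mom2 : Integrable fun x => x ^ 2 * E x)
    (hE_var : ∫ x, x ^ 2 * E x = σ ^ 2) (hσ : 0 < σ) {A η : ℝ} (hA : 0 ≤ A) (hη : 0 < η) :
    ∃ p, 0 < p ∧ ∃ n₀ : ℕ, ∀ n : ℕ, n₀ ≤ n → ∀ α, |α| ≤ A / √n →
      TubeBound E n α (η * √n) p := by
  set a := A / η with ha
  set w₀ := σ ^ 2 / η ^ 2 with hw₀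
  set w₁ := (σ ^ 2 + A ^ 2) / η ^ 2 with hw₁
  have ha0 : 0 ≤ a := by positivity
  have hw₀0 : 0 < w₀ := by positivity
  have hw₁0 : 0 < w₁ := by positivity
  set M := 2 + (2 * a + 1) / w₀ with hM
  have hM2 : 2 ≤ M := le_add_of_nonneg_right (by positivity)
  have hMw : 2 * a + 1 ≤ M * w₀ := by
    rw [hM, add_mul, div_mul_cancel₀ _ hw₀0.ne']
    linarith
  have hMa : 2 * M * a + 1 ≤ M ^ 2 * w₀ := by nlinarith
  set e := Real.exp (-M) with he
  have he0 : 0 < e := Real.exp_pos _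
  have hgap : 0 < Real.exp (-(3 / 4) * M) - e :=
    sub_pos.2 (Real.exp_lt_exp.2 (by linarith))
  set C := (2 * M * a + M * w₁ + 1) / (Real.exp (-(3 / 4) * M) - e) with hC
  have hC0 : 0 ≤ C := by positivity
  have hCle : 2 * M * a + M * w₁ + 1 ≤ C * (Real.exp (-(3 / 4) * M) - e) := by
    rw [hC, div_mul_cancel₀ _ hgap.ne']
  set δ := min (1 / (3 * M)) (e / (58 * M ^ 3 * w₁)) with hδ
  have hδ0 : 0 < δ := by positivity
  have hδM : 3 * M * δ ≤ 1 := by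
    rw [mul_comm, ← le_div_iff₀ (by positivity)]; exact min_le_left _ _
  have hδe : 29 * M ^ 3 * δ * w₁ ≤ e / 2 := by
    have : δ * (58 * M ^ 3 * w₁) ≤ e := by
      rw [← le_div_iff₀ (by positivity)]; exact min_le_right _ _
    linarith
  set K := 1 / δ ^ 2 + 2 * M / δ + 2 * M ^ 2 with hK
  have hK0 : 0 < K := by positivity
  have htend : Tendsto (fun n : ℕ => δ * (η * √(n : ℝ))) atTop atTop :=
    ((Real.tendsto_sqrt_atTop.comp tendsto_natCast_atTop_atTop).const_mul_atTop hη).const_mul_atTop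
      hδ0
  have hev := ((tendsto_truncated_second_moment hE0 hE_int hE_mom2 A).comp htend).eventually_le_const
    (show (0 : ℝ) < e / 2 * (η ^ 2 / K) by positivity)
  obtain ⟨n₁, hn₁⟩ := eventually_atTop.1 hev
  obtain ⟨n₂, hn₂⟩ := exists_nat_ge (2 * C)
  have h1e : 0 < 1 - e := by
    have : e < 1 := by rw [he, ← Real.exp_zero]; exact Real.exp_lt_exp.2 (by linarith)
    linarith
  refine ⟨Real.exp (-(2 * C)) * (1 - e), by positivity, max n₁ (max n₂ 1), fun n hn α hα => ?_⟩
  have hnn₁ : n₁ ≤ n := (le_max_left _ _).trans hn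
  have hnn₂ : n₂ ≤ n := (le_max_left _ _).trans ((le_max_right _ _).trans hn)
  have hn1 : 1 ≤ n := (le_max_right _ _).trans ((le_max_right _ _).trans hn)
  have hnR : (1 : ℝ) ≤ n := by exact_mod_cast hn1
  have h2C : 2 * C ≤ n := hn₂.trans (by exact_mod_cast hnn₂)
  have htail := hn₁ n hnn₁
  simp only [Function.comp_apply] at htail
  have hsq : √(n : ℝ) * √n = n := Real.mul_self_sqrt (by linarith)
  have hsq1 : 1 ≤ √(n : ℝ) := Real.one_le_sqrt.2 hnR
  set ρ := η * √(n : ℝ) with hρ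
  have hρ0 : 0 < ρ := by positivity
  have hρ2 : ρ ^ 2 = η ^ 2 * n := by rw [hρ, mul_pow, pow_two √(n : ℝ), hsq]
  have hαA : |α| ≤ A := hα.trans (div_le_self hA hsq1)
  let ψ : ℕ → ℝ → ℝ := fun j y => Real.exp (-M * ((y - j * α) / ρ) ^ 2) - e
  have hexp1 : ∀ x : ℝ, Real.exp (-M * x ^ 2) ≤ 1 := fun x => by
    rw [Real.exp_le_one_iff]; nlinarith [sq_nonneg x]
  have hsupp : ∀ j y, 0 < ψ j y → |(y - j * α) / ρ| ≤ 1 := by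
    intro j y h
    have h1 : Real.exp (-M) < Real.exp (-M * ((y - j * α) / ρ) ^ 2) := by
      simpa [ψ, he] using h
    rw [Real.exp_lt_exp] at h1
    rw [← sq_le_one_iff_abs_le_one]
    by_contra hc
    nlinarith
  have hT : TubeBound E n α ρ ((1 - C / n) ^ n * ψ 0 0) := by
    refine tubeBound_of_subsolution (q := 1 - C / n) (ψ := ψ) hE0 hE_int ?_ (fun j => ?_) (fun j y => ?_)
      (fun j y h _ => ?_) (fun j y h _ => ?_)
    · rw [sub_nonneg, div_le_one (by linarith)]
      linarith
    · exact (by fun_prop : Continuous (ψ j)).measurable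
    · have := hexp1 ((y - j * α) / ρ)
      have := Real.exp_pos (-M * ((y - j * α) / ρ) ^ 2)
      simp only [ψ]
      exact abs_le.2 ⟨by linarith, by linarith⟩
    · have := hsupp j y h
      rwa [abs_div, abs_of_pos hρ0, div_le_one hρ0] at this
    · have hξ := hsupp j y h
      set ξ := (y - j * α) / ρ with hξdef
      have hstep := gaussian_step_lower_bound hE0 hE_int hE_mass hE_mom1 hE_mean hE_mom2 hE_var
        hαA hρ0 (by linarith : 1 ≤ M) hξ hδ0 hδM
      have hgen := gaussian_generator_bound (s := n * (α / ρ)) (w := (σ ^ 2 + α ^ 2) / η ^ 2)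
        (err := 29 * M ^ 3 * δ * ((σ ^ 2 + α ^ 2) / η ^ 2) + K / η ^ 2 *
          ∫ x, E x * (if δ * ρ < |x| + A then (|x| + A) ^ 2 else 0))
        hM2 ha0 hMa hw₀0.le hC0 hCle hξ ?_ ?_ ?_ ?_
      · have hintegral : ∫ x, E x * ψ (j + 1) (y + x) =
            (∫ x, E x * Real.exp (-M * (ξ + (x - α) / ρ) ^ 2)) - e := by
          have i1 : Integrable fun x => E x * Real.exp (-M * (ξ + (x - α) / ρ) ^ 2) := by
            refine hE_int.mul_bdd (c := 1) ?_ (ae_of_all _ fun x => ?_)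
            · exact (by fun_prop : Continuous fun x : ℝ =>
                Real.exp (-M * (ξ + (x - α) / ρ) ^ 2)).aestronglyMeasurable
            · rw [Real.norm_of_nonneg (Real.exp_pos _).le]
              exact hexp1 _
          have i2 := hE_int.mul_const e
          have := integral_sub i1 i2
          rw [integral_mul_const, hE_mass, one_mul] at this
          rw [← this]
          congr 1
          funext x
          have : (y + x - (j + 1 : ℕ) * α) / ρ = ξ + (x - α) / ρ := by
            rw [hξdef]; push_cast; field_simp; ring
          simp only [ψ, this]
          ring
        have hψj : ψ j y = Real.exp (-M * ξ ^ 2) - e := rfl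
        rw [hintegral, hψj]
        set G := Real.exp (-M * ξ ^ 2)
        set I := ∫ x, E x * (if δ * ρ < |x| + A then (|x| + A) ^ 2 else 0)
        have hn0 : (n : ℝ) ≠ 0 := by positivity
        have hscale : G * (1 + 2 * M * ξ * (α / ρ) +
              (2 * M ^ 2 * ξ ^ 2 - M) * ((σ ^ 2 + α ^ 2) / ρ ^ 2))
            - 29 * M ^ 3 * δ * ((σ ^ 2 + α ^ 2) / ρ ^ 2) - K / ρ ^ 2 * I - e =
            (1 - C / n) * (G - e) + (C * (G - e) + G * (2 * M * ξ * (n * (α / ρ)) +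
              (2 * M ^ 2 * ξ ^ 2 - M) * ((σ ^ 2 + α ^ 2) / η ^ 2)) -
              (29 * M ^ 3 * δ * ((σ ^ 2 + α ^ 2) / η ^ 2) + K / η ^ 2 * I)) / n := by
          rw [hρ2]
          field_simp
          ring
        have hdiv := div_nonneg hgen (by linarith : (0 : ℝ) ≤ n)
        linarith
      · rw [abs_mul, abs_div, abs_of_pos hρ0, abs_of_pos (by linarith : (0 : ℝ) < n), ha,
          ← mul_div_assoc, div_le_div_iff₀ hρ0 hη]
        have : |α| * √(n : ℝ) ≤ A := by rwa [← le_div_iff₀ (by linarith)]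
        calc n * |α| * η = |α| * (√(n : ℝ) * √n) * η := by rw [hsq]; ring
          _ = |α| * √(n : ℝ) * (√n * η) := by ring
          _ ≤ A * (√n * η) := by gcongr
          _ = A * ρ := by rw [hρ]; ring
      · rw [hw₀]; gcongr; nlinarith [sq_nonneg α]
      · rw [hw₁, ← sq_abs α]; gcongr
      · have h1 : 29 * M ^ 3 * δ * ((σ ^ 2 + α ^ 2) / η ^ 2) ≤ e / 2 := by
          refine le_trans ?_ hδe
          rw [hw₁, ← sq_abs α]
          gcongr
        have h2 : K / η ^ 2 * ∫ x, E x * (if δ * ρ < |x| + A then (|x| + A) ^ 2 else 0) ≤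
            e / 2 := by
          calc _ ≤ K / η ^ 2 * (e / 2 * (η ^ 2 / K)) := by gcongr
            _ = e / 2 := by field_simp
        linarith
  refine hT.mono ?_
  have h00 : ψ 0 0 = 1 - e := by simp [ψ]
  rw [h00]
  exact mul_le_mul_of_nonneg_right (exp_neg_two_mul_le_pow hC0 h2C (by omega)) h1e.le

/-- The last two heights `u, v` of a path are at the diffusive scale `L`: height about
`L ^ (3 / 2)` and slope small compared with `L ^ (1 / 2)`. -/
def AtScale (L : ℕ) (u v : ℝ) : Prop :=
  |v - L * √L| ≤ L * √L / 32 ∧ |v - u| ≤ √L / 32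

lemma sqrt_le_three_mul_sqrt {L n : ℕ} (h : L ≤ 8 * n) : √(L : ℝ) ≤ 3 * √(n : ℝ) := by
  rw [Real.sqrt_le_left (by positivity), mul_pow, Real.sq_sqrt (by positivity)]
  have : (L : ℝ) ≤ 8 * n := by exact_mod_cast h
  have : (0 : ℝ) ≤ n := by positivity
  linarith

lemma scale_bounds {L n : ℕ} (h1 : n ≤ L) (h2 : L ≤ 8 * n) :
    √(n : ℝ) ≤ √L ∧ √(L : ℝ) ≤ 3 * √n ∧ (n : ℝ) * √n ≤ L * √L ∧
      (L : ℝ) * √L ≤ 24 * (n * √n) := by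
  have h1' : (n : ℝ) ≤ L := by exact_mod_cast h1
  have h2' : (L : ℝ) ≤ 8 * n := by exact_mod_cast h2
  have h3 := Real.sqrt_le_sqrt h1'
  have h4 := sqrt_le_three_mul_sqrt h2
  refine ⟨h3, h4, by gcongr, ?_⟩
  calc (L : ℝ) * √L ≤ (8 * n) * (3 * √n) := by gcongr
    _ = _ := by ring

/-- In `2 n` steps a path passes from scale `L` to scale `L'`, both comparable to `n`, with
probability bounded below. -/
lemma exists_pathMass_atScale_ge {E : ℝ → ℝ}
    (hT : ∃ p, 0 < p ∧ ∃ n₀ : ℕ, ∀ n : ℕ, n₀ ≤ n → ∀ α, |α| ≤ 26 / √n →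
      TubeBound E n α (1 / 96 * √n) p) :
    ∃ p, 0 < p ∧ ∃ n₀ : ℕ, ∀ n : ℕ, n₀ ≤ n → ∀ L L' : ℕ, n ≤ L → L ≤ 8 * n → n ≤ L' →
      L' ≤ 8 * n → ∀ (m : ℕ) (b : ℝ), 0 ≤ b →
      (∀ u v, AtScale L' u v → ENNReal.ofReal b ≤ pathMass E (Ici 0) m u v) →
      ∀ u v, AtScale L u v → ENNReal.ofReal (p * b) ≤ pathMass E (Ici 0) (m + 2 * n) u v := by
  obtain ⟨p, hp, n₀, hT⟩ := hT
  refine ⟨p ^ 2, by positivity, max n₀ 1, fun n hn L L' hL1 hL2 hL1' hL2' m b hb hend u v huv => ?_⟩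
  have hn1 : 1 ≤ n := (le_max_right _ _).trans hn
  have hnR : (1 : ℝ) ≤ n := by exact_mod_cast hn1
  obtain ⟨hs1, hs2, hs3, hs4⟩ := scale_bounds hL1 hL2
  obtain ⟨hs1', hs2', hs3', hs4'⟩ := scale_bounds hL1' hL2'
  obtain ⟨hv, hy⟩ := huv
  have hv' := abs_le.1 hv
  have hs : 1 ≤ √(n : ℝ) := Real.one_le_sqrt.2 hnR
  have hsq : √(n : ℝ) * √n = n := Real.mul_self_sqrt (by linarith)
  have hny : n * |v - u| ≤ n * √n * (3 / 32) := by
    calc n * |v - u| ≤ n * (3 * √n / 32) := by gcongr; linarith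
      _ = _ := by ring
  have hns : 0 ≤ (n : ℝ) * √n := by positivity
  refine pathMass_ge_of_tubeBound hn1 (by positivity) hp.le (hT n ((le_max_left _ _).trans hn))
    (Z := L' * √L') hb (by linarith) (by linarith) ?_ ?_
  · have h1 : |L' * √(L' : ℝ) - v| / n ^ 2 ≤ 25 / √n := by
      have : |L' * √(L' : ℝ) - v| ≤ 25 * (n * √n) := abs_le.2 ⟨by linarith, by linarith⟩
      calc _ ≤ 25 * (n * √n) / (n : ℝ) ^ 2 := by gcongr
        _ = 25 * (n * √n) / (n * (√n * √n)) := by rw [hsq, pow_two]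
        _ = 25 / √n := by field_simp
    have h2 : 3 * |v - u| / n ≤ 1 / √n := by
      rw [div_le_div_iff₀ (by linarith) (by linarith)]
      nlinarith
    calc _ ≤ 25 / √n + 1 / √(n : ℝ) := add_le_add h1 h2
      _ = 26 / √n := by ring
  · intro u' v' hy' hz'
    refine hend u' v' ⟨hz'.trans ?_, hy'.trans ?_⟩ <;> linarith

lemma exists_pathMass_start_ge {E : ℝ → ℝ} (hE0 : ∀ x, 0 ≤ E x) (hE_int : Integrable E)
    {r d : ℝ} (hr : 0 < r) (hr1 : r ≤ 1) (hd : 0 < d) (hE : ∀ x, |x| ≤ r → d ≤ E x) :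
    ∃ n₀ : ℕ, ∀ n : ℕ, n₀ ≤ n → ∃ c, 0 < c ∧ ∀ (m : ℕ) (b : ℝ), 0 ≤ b →
      (∀ u v, AtScale (2 * n + 2) u v → ENNReal.ofReal b ≤ pathMass E (Ici 0) m u v) →
      ENNReal.ofReal (c * b) ≤ pathMass E (Ici 0) (m + (2 * n + 2)) 0 0 := by
  obtain ⟨n₁, hn₁⟩ := exists_nat_ge ((56 / r) ^ 2)
  refine ⟨max n₁ 1, fun n hn => ?_⟩
  have hn1 : 1 ≤ n := (le_max_right _ _).trans hn
  have hnR : (1 : ℝ) ≤ n := by exact_mod_cast hn1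
  have hsr : 56 / r ≤ √(n : ℝ) := by
    refine Real.le_sqrt_of_sq_le (hn₁.trans ?_)
    exact_mod_cast (le_max_left _ _).trans hn
  have hs : 1 ≤ √(n : ℝ) := Real.one_le_sqrt.2 hnR
  have hsq : √(n : ℝ) * √n = n := Real.mul_self_sqrt (by linarith)
  obtain ⟨κ, hκ⟩ : ∃ κ, κ = r / 8 := ⟨_, rfl⟩
  obtain ⟨ρ, hρ⟩ : ∃ ρ, n * ρ = κ / 48 := ⟨κ / 48 / n, by field_simp⟩
  have hρ0 : 0 < ρ := by
    by_contra hc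
    nlinarith
  have hρκ : ρ ≤ κ / 48 := by nlinarith
  obtain ⟨p, hp, hT⟩ := exists_tubeBound_of_pos hE0 hE_int hr hd hE n hρ0
  refine ⟨d * (d * p ^ 2 * ρ) * ρ, by positivity, fun m b hb hend => ?_⟩
  obtain ⟨hs1, hs2, hs3, hs4⟩ := scale_bounds (L := 2 * n + 2) (n := n) (by omega) (by omega)
  have hns : 1 ≤ (n : ℝ) * √n := by nlinarith
  have hmid : ∀ u ∈ Icc κ (κ + ρ), ∀ v ∈ Icc κ (κ + ρ),
      ENNReal.ofReal (p ^ 2 * b) ≤ pathMass E (Ici 0) (m + 2 * n) u v := by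
    intro u hu v hv
    have hy : |v - u| ≤ ρ := abs_le.2 ⟨by linarith [hu.2, hv.1], by linarith [hu.1, hv.2]⟩
    have hny : n * |v - u| ≤ κ / 48 := hρ ▸ (by gcongr)
    refine pathMass_ge_of_tubeBound hn1 hρ0.le hp.le hT
      (Z := (2 * n + 2 : ℕ) * √(2 * n + 2 : ℕ)) hb (by linarith [hv.1]) (by linarith) ?_ ?_
    · have h1 : |(2 * n + 2 : ℕ) * √((2 * n + 2 : ℕ) : ℝ) - v| / n ^ 2 ≤ 25 / √n := by
        have : |(2 * n + 2 : ℕ) * √((2 * n + 2 : ℕ) : ℝ) - v| ≤ 25 * (n * √n) :=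
          abs_le.2 ⟨by linarith [hv.2], by linarith [hv.1]⟩
        calc _ ≤ 25 * (n * √n) / (n : ℝ) ^ 2 := by gcongr
          _ = 25 * (n * √n) / (n * (√n * √n)) := by rw [hsq, pow_two]
          _ = 25 / √n := by field_simp
      have h2 : 3 * |v - u| / n ≤ 1 / √n := by
        rw [div_le_div_iff₀ (by linarith) (by linarith)]
        nlinarith
      have h3 : 28 / √(n : ℝ) ≤ r / 2 := by
        rw [div_le_iff₀ hr] at hsr
        rw [div_le_div_iff₀ (by linarith) (by norm_num)]
        linarith
      calc _ ≤ 25 / √n + 1 / √(n : ℝ) := add_le_add h1 h2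
        _ = 26 / √n := by ring
        _ ≤ 28 / √n := by gcongr; norm_num
        _ ≤ _ := h3
    · intro u' v' hy' hz'
      refine hend u' v' ⟨hz'.trans ?_, hy'.trans ?_⟩ <;> linarith
  have h1 : ∀ w ∈ Icc κ (κ + ρ),
      ENNReal.ofReal (d * (p ^ 2 * b) * ρ) ≤ pathMass E (Ici 0) (m + 2 * n + 1) 0 w := by
    intro w hw
    refine pathMass_succ_ge hd.le (by positivity) (by linarith) (fun w' hw' => hE _ ?_)
      (fun w' hw' => hmid w hw w' hw')
    exact abs_le.2 ⟨by linarith [hw.2, hw'.1], by linarith [hw.1, hw'.2]⟩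
  have h2 := pathMass_succ_ge (E := E) (u := 0) (v := 0) hd.le
    (by positivity : 0 ≤ d * (p ^ 2 * b) * ρ) (by linarith : 0 ≤ κ) (fun w hw => hE _ (by
      exact abs_le.2 ⟨by linarith [hw.1], by linarith [hw.2]⟩)) h1
  rw [show d * (d * p ^ 2 * ρ) * ρ * b = d * (d * (p ^ 2 * b) * ρ) * ρ by ring]
  exact h2

set_option maxHeartbeats 1000000 in
lemma exists_pathMass_end_ge {E : ℝ → ℝ} (hE0 : ∀ x, 0 ≤ E x) (hE_int : Integrable E)
    {r d : ℝ} (hr : 0 < r) (hr1 : r ≤ 1) (hd : 0 < d) (hE : ∀ x, |x| ≤ r → d ≤ E x) :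
    ∃ m₀ : ℕ, ∀ m : ℕ, m₀ ≤ m → ∃ c, 0 < c ∧
      ∀ u v, AtScale m u v → ENNReal.ofReal c ≤ pathMass E (Ici 0) m u v := by
  obtain ⟨n₁, hn₁⟩ := exists_nat_ge ((56 / r) ^ 2)
  refine ⟨3 * (max n₁ 1), fun m hm => ?_⟩
  obtain ⟨n, hn⟩ : ∃ n, n = m / 3 := ⟨_, rfl⟩
  obtain ⟨e, he⟩ : ∃ e, e = m % 3 := ⟨_, rfl⟩
  have hmn : m = e + 2 * n + n := by omega
  have hnn : max n₁ 1 ≤ n := by omega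
  have hn1 : 1 ≤ n := (le_max_right _ _).trans hnn
  have hnR : (1 : ℝ) ≤ n := by exact_mod_cast hn1
  have hsr : 56 / r ≤ √(n : ℝ) := by
    refine Real.le_sqrt_of_sq_le (hn₁.trans ?_)
    exact_mod_cast (le_max_left _ _).trans hnn
  have hs : 1 ≤ √(n : ℝ) := Real.one_le_sqrt.2 hnR
  have hsq : √(n : ℝ) * √n = n := Real.mul_self_sqrt (by linarith)
  have hsr' : 28 / √(n : ℝ) ≤ r / 2 := by
    rw [div_le_iff₀ hr] at hsr
    rw [div_le_div_iff₀ (by linarith) (by norm_num)]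
    linarith
  obtain ⟨κ, hκ⟩ : ∃ κ, κ = r / 16 := ⟨_, rfl⟩
  obtain ⟨ρ, hρ⟩ : ∃ ρ, n * ρ = κ / 12 := ⟨κ / 12 / n, by field_simp⟩
  have hρ0 : 0 < ρ := by
    by_contra hc
    nlinarith
  have hρκ : ρ ≤ κ / 12 := by nlinarith
  obtain ⟨p, hp, hT⟩ := exists_tubeBound_of_pos hE0 hE_int hr hd hE n hρ0
  obtain ⟨c, hc, hend⟩ := exists_pathMass_lower_bound hr hd hE e
  refine ⟨p * (p ^ 2 * c), by positivity, fun u v huv => ?_⟩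
  obtain ⟨hs1, hs2, hs3, hs4⟩ := scale_bounds (L := m) (n := n) (by omega) (by omega)
  have hns : 1 ≤ (n : ℝ) * √n := by nlinarith
  obtain ⟨hv, hy⟩ := huv
  have hv' := abs_le.1 hv
  obtain ⟨g, hg⟩ : ∃ g, v - u = g * n := ⟨(v - u) / n, by field_simp⟩
  have hgn : |g| * n = |v - u| := by rw [hg, abs_mul, abs_of_pos (by linarith : (0 : ℝ) < n)]
  have hgs : |g| * √(n : ℝ) ≤ 3 / 32 := by
    have : |g| * √(n : ℝ) * √n ≤ 3 / 32 * √n := by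
      rw [mul_assoc, hsq, hgn]; linarith
    exact le_of_mul_le_mul_right this (by linarith)
  have hgnn : |g| * n * n ≤ 3 / 32 * (n * √n) := by
    rw [hgn]
    nlinarith
  have hα : |-g| ≤ r / 2 := by
    rw [abs_neg]
    refine le_trans ?_ hsr'
    rw [le_div_iff₀ (by linarith)]
    linarith
  have hshift : ∀ t : ℝ, 0 ≤ t → t ≤ n * n → |g * t| ≤ 3 / 32 * (n * √n) := by
    intro t ht0 ht1
    rw [abs_mul, abs_of_nonneg ht0]
    calc |g| * t ≤ |g| * (n * n) := by gcongr
      _ ≤ _ := by linarith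
  rw [hmn]
  refine hT _ hα (e + 2 * n) u v (p ^ 2 * c) (by positivity) ?_ ?_
  · intro j hj
    have hj0 : (0 : ℝ) ≤ j := by positivity
    have hjn : (j : ℝ) ≤ n := by exact_mod_cast hj
    have h1 := abs_le.1 (hshift (n * j - j * (j + 1) / 2) (by nlinarith) (by nlinarith))
    have h2 : j * ρ ≤ n * ρ := by gcongr
    rw [hg]
    linarith [h1.1]
  · intro u₁ v₁ hy₁ hv₁
    rw [hg, show v₁ - u₁ - (g * n + n * -g) = v₁ - u₁ by ring] at hy₁
    have h1 := abs_le.1 (hshift (n * n - n * (n + 1) / 2) (by nlinarith) (by nlinarith))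
    rw [hg] at hv₁
    have hv₁' := abs_le.1 hv₁
    have hny : n * |v₁ - u₁| ≤ κ / 12 := hρ ▸ (by gcongr)
    have hlow : n * √n / 2 ≤ v₁ := by linarith [h1.1, hv₁'.1]
    have hupp : v₁ ≤ 26 * (n * √n) := by linarith [h1.2, hv₁'.2]
    refine pathMass_ge_of_tubeBound hn1 hρ0.le hp.le hT (Z := κ) hc.le (by linarith)
      (by linarith) ?_ ?_
    · have h1 : |κ - v₁| / n ^ 2 ≤ 26 / √n := by
        have : |κ - v₁| ≤ 26 * (n * √n) := abs_le.2 ⟨by linarith, by linarith⟩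
        calc _ ≤ 26 * (n * √n) / (n : ℝ) ^ 2 := by gcongr
          _ = 26 * (n * √n) / (n * (√n * √n)) := by rw [hsq, pow_two]
          _ = 26 / √n := by field_simp
      have h2 : 3 * |v₁ - u₁| / n ≤ 1 / √n := by
        rw [div_le_div_iff₀ (by linarith) (by linarith)]
        nlinarith
      calc _ ≤ 26 / √n + 1 / √(n : ℝ) := add_le_add h1 h2
        _ = 27 / √n := by ring
        _ ≤ 28 / √n := by gcongr; norm_num
        _ ≤ _ := hsr'
    · intro u₂ v₂ hy₂ hv₂
      have hy₂' := abs_le.1 hy₂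
      have hv₂' := abs_le.1 hv₂
      exact hend u₂ v₂ ⟨by linarith, by linarith⟩ ⟨by linarith, by linarith⟩

/-- A bound that loses a constant factor each time the index is (roughly) doubled loses only
polynomially. -/
lemma exists_polynomial_bound_of_halving {P : ℕ → ℝ → Prop}
    (hmono : ∀ m c c', c' ≤ c → P m c → P m c') {M₀ : ℕ}
    (hbase : ∀ m, M₀ ≤ m → ∃ c, 0 < c ∧ P m c) {p : ℝ} (hp : 0 < p) {n₀ : ℕ}
    (hstep : ∀ n m, n₀ ≤ n → 4 * n ≤ m → m < 4 * n + 4 → ∀ c, 0 ≤ c →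
      P (m - 2 * n) c → P m (p * c)) :
    ∃ c, 0 < c ∧ ∃ K M₁ : ℕ, ∀ m, M₁ ≤ m → P m (c / m ^ K) := by
  have hfin : ∀ k, ∃ c, 0 < c ∧ ∀ m, M₀ ≤ m → m < k → P m c := by
    intro k
    induction k with
    | zero => exact ⟨1, one_pos, fun m _ h => absurd h (Nat.not_lt_zero m)⟩
    | succ k ih =>
      obtain ⟨c, hc, h⟩ := ih
      by_cases hk : M₀ ≤ k
      · obtain ⟨c', hc', h'⟩ := hbase k hk
        refine ⟨min c c', lt_min hc hc', fun m hm hmk => ?_⟩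
        rcases Nat.lt_succ_iff_lt_or_eq.1 hmk with hlt | rfl
        · exact hmono m c _ (min_le_left _ _) (h m hm hlt)
        · exact hmono m c' _ (min_le_right _ _) h'
      · exact ⟨c, hc, fun m hm hmk => h m hm (by omega)⟩
  obtain ⟨M₁, hM₁⟩ : ∃ M₁, M₁ = M₀ + 4 * n₀ + 8 := ⟨_, rfl⟩
  obtain ⟨c, hc, hsmall⟩ := hfin (2 * M₁)
  obtain ⟨K, hK⟩ := pow_unbounded_of_one_lt (1 / p) (by norm_num : (1 : ℝ) < 4 / 3)
  have hpK : 1 ≤ p * (4 / 3 : ℝ) ^ K := by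
    rw [div_lt_iff₀ hp] at hK
    linarith
  refine ⟨c, hc, K, M₁, fun m => ?_⟩
  induction m using Nat.strong_induction_on with
  | _ m ih =>
    intro hm
    have hm1 : (1 : ℝ) ≤ m := by exact_mod_cast (by omega : 1 ≤ m)
    rcases lt_or_ge m (2 * M₁) with hlt | hge
    · exact hmono m c _ (div_le_self hc.le (one_le_pow₀ hm1)) (hsmall m (by omega) hlt)
    · obtain ⟨n, hn⟩ : ∃ n, n = m / 4 := ⟨_, rfl⟩
      obtain ⟨k, hk⟩ : ∃ k, k = m - 2 * n := ⟨_, rfl⟩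
      have hPk := ih k (by omega) (by omega)
      have hPm := hstep n m (by omega) (by omega) (by omega) (c / k ^ K) (by positivity)
        (hk ▸ hPk)
      refine hmono m _ _ ?_ hPm
      have hk1 : (1 : ℝ) ≤ k := by exact_mod_cast (by omega : 1 ≤ k)
      have hkm : (4 / 3 : ℝ) * k ≤ m := by
        have : (4 * k : ℝ) ≤ 3 * m := by exact_mod_cast (by omega : 4 * k ≤ 3 * m)
        linarith
      rw [← mul_div_assoc, div_le_div_iff₀ (by positivity) (by positivity)]
      calc c * (k : ℝ) ^ K ≤ (p * (4 / 3 : ℝ) ^ K) * (c * (k : ℝ) ^ K) :=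
            le_mul_of_one_le_left (by positivity) hpK
        _ = p * c * ((4 / 3 : ℝ) * k) ^ K := by rw [mul_pow]; ring
        _ ≤ p * c * (m : ℝ) ^ K := by gcongr

lemma exists_pathMass_polynomial_bound {E : ℝ → ℝ} {σ : ℝ}
    (hE_nonneg : ∀ x, 0 ≤ E x) (hE_cont : Continuous E) (hE_pos : 0 < E 0)
    (hE_int : Integrable E) (hE_mass : ∫ x, E x = 1)
    (hE_mom1 : Integrable fun x => x * E x) (hE_mean : ∫ x, x * E x = 0)
    (hE_mom2 : Integrable fun x => x ^ 2 * E x) (hE_var : ∫ x, x ^ 2 * E x = σ ^ 2)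
    (hσ : 0 < σ) :
    ∃ c, 0 < c ∧ ∃ K : ℕ, ∀ m : ℕ,
      ENNReal.ofReal (c / (m + 1 : ℝ) ^ K) ≤ pathMass E (Ici 0) m 0 0 := by
  obtain ⟨r, d, hr, hr1, hd, hE⟩ :
      ∃ r d : ℝ, 0 < r ∧ r ≤ 1 ∧ 0 < d ∧ ∀ x, |x| ≤ r → d ≤ E x := by
    have hev : ∀ᶠ x in 𝓝 (0 : ℝ), E 0 / 2 < E x :=
      hE_cont.continuousAt.eventually_const_lt (by linarith)
    obtain ⟨s, hs, hball⟩ := Metric.eventually_nhds_iff.1 hev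
    refine ⟨min (s / 2) 1, E 0 / 2, by positivity, min_le_right _ _, by positivity,
      fun x hx => (hball ?_).le⟩
    rw [Real.dist_eq, sub_zero]
    have := min_le_left (s / 2) 1
    linarith
  obtain ⟨p, hp, n₀, hmove⟩ := exists_pathMass_atScale_ge (exists_tubeBound_diffusive hE_nonneg
    hE_int hE_mass hE_mom1 hE_mean hE_mom2 hE_var hσ (by norm_num : (0 : ℝ) ≤ 26)
    (by norm_num : (0 : ℝ) < 1 / 96))
  obtain ⟨mE, hend⟩ := exists_pathMass_end_ge hE_nonneg hE_int hr hr1 hd hE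
  obtain ⟨nS, hstart⟩ := exists_pathMass_start_ge hE_nonneg hE_int hr hr1 hd hE
  obtain ⟨cD, hcD, KD, MD, hdown⟩ := exists_polynomial_bound_of_halving
    (P := fun m c => ∀ u v, AtScale m u v → ENNReal.ofReal c ≤ pathMass E (Ici 0) m u v)
    (fun m c c' hcc h u v huv => (ENNReal.ofReal_le_ofReal hcc).trans (h u v huv))
    hend hp (n₀ := n₀ + 1) (fun n m hn h1 h2 c hc hP u v huv => by
      have := hmove n (by omega) m (m - 2 * n) (by omega) (by omega) (by omega) (by omega)
        (m - 2 * n) c hc hP u v huv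
      rwa [show m - 2 * n + 2 * n = m by omega] at this)
  obtain ⟨cU, hcU, KU, MU, hup⟩ := exists_polynomial_bound_of_halving
    (P := fun t c => Even t → ∀ (m : ℕ) (b : ℝ), 0 ≤ b →
      (∀ u v, AtScale t u v → ENNReal.ofReal b ≤ pathMass E (Ici 0) m u v) →
      ENNReal.ofReal (c * b) ≤ pathMass E (Ici 0) (m + t) 0 0)
    (fun t c c' hcc h ht m b hb hm =>
      (ENNReal.ofReal_le_ofReal (mul_le_mul_of_nonneg_right hcc hb)).trans (h ht m b hb hm))
    (M₀ := 2 * nS + 2) (fun t ht => by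
      by_cases hev : Even t
      · obtain ⟨k, hk⟩ := hev
        obtain ⟨c, hc, h⟩ := hstart (k - 1) (by omega)
        rw [show 2 * (k - 1) + 2 = t by omega] at h
        exact ⟨c, hc, fun _ => h⟩
      · exact ⟨1, one_pos, fun h => absurd h hev⟩)
    hp (n₀ := n₀ + 1) (fun n t hn h1 h2 c hc hP hev m b hb hm => by
      have h3 := hmove n (by omega) (t - 2 * n) t (by omega) (by omega) (by omega) (by omega)
        m b hb hm
      have h4 := hP (by rw [Nat.even_sub (by omega)]; simp [hev]) (m + 2 * n) (p * b)
        (by positivity) h3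
      rw [show m + 2 * n + (t - 2 * n) = m + t by omega] at h4
      rwa [show p * c * b = c * (p * b) by ring])
  obtain ⟨N₁, hN₁⟩ : ∃ N₁, N₁ = n₀ + MD + MU + 5 := ⟨_, rfl⟩
  have hsmall : ∀ k : ℕ, ∃ c, 0 < c ∧ ∀ m, m < k →
      ENNReal.ofReal c ≤ pathMass E (Ici 0) m 0 0 := by
    intro k
    induction k with
    | zero => exact ⟨1, one_pos, fun m h => absurd h (Nat.not_lt_zero m)⟩
    | succ k ih =>
      obtain ⟨c, hc, h⟩ := ih
      obtain ⟨c', hc', h'⟩ := exists_pathMass_lower_bound hr hd hE k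
      refine ⟨min c c', lt_min hc hc', fun m hmk => ?_⟩
      rcases Nat.lt_succ_iff_lt_or_eq.1 hmk with hlt | rfl
      · exact (ENNReal.ofReal_le_ofReal (min_le_left _ _)).trans (h m hlt)
      · exact (ENNReal.ofReal_le_ofReal (min_le_right _ _)).trans
          (h' 0 0 ⟨le_rfl, by positivity⟩ ⟨le_rfl, by positivity⟩)
  obtain ⟨c₀, hc₀, hsmall⟩ := hsmall (6 * N₁)
  refine ⟨min c₀ (cU * (p * cD)), by positivity, KU + KD, fun m => ?_⟩
  have hm1 : (1 : ℝ) ≤ m + 1 := by linarith [(Nat.cast_nonneg m : (0 : ℝ) ≤ m)]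
  rcases lt_or_ge m (6 * N₁) with hlt | hge
  · refine (ENNReal.ofReal_le_ofReal ?_).trans (hsmall m hlt)
    exact (div_le_self (by positivity) (one_le_pow₀ hm1)).trans (min_le_left _ _)
  · obtain ⟨n, hn⟩ : ∃ n, n = m / 6 := ⟨_, rfl⟩
    obtain ⟨k, hk⟩ : ∃ k, k = m - 4 * n := ⟨_, rfl⟩
    have h1 := hdown k (by omega)
    have h2 := hmove n (by omega) (2 * n) k (by omega) (by omega) (by omega) (by omega) k
      (cD / k ^ KD) (by positivity) h1
    have h3 := hup (2 * n) (by omega) (even_two_mul n) (k + 2 * n) (p * (cD / k ^ KD))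
      (by positivity) h2
    rw [show k + 2 * n + 2 * n = m by omega] at h3
    refine (ENNReal.ofReal_le_ofReal ?_).trans h3
    have hk1 : (k : ℝ) ≤ m + 1 := by exact_mod_cast (by omega : k ≤ m + 1)
    have hn1 : ((2 * n : ℕ) : ℝ) ≤ m + 1 := by exact_mod_cast (by omega : 2 * n ≤ m + 1)
    have hk0 : (0 : ℝ) < k := by exact_mod_cast (by omega : 0 < k)
    have hn0 : (0 : ℝ) < (2 * n : ℕ) := by exact_mod_cast (by omega : 0 < 2 * n)
    calc min c₀ (cU * (p * cD)) / (m + 1 : ℝ) ^ (KU + KD)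
        ≤ cU * (p * cD) / (m + 1 : ℝ) ^ (KU + KD) := by
          gcongr
          exact min_le_right _ _
      _ = cU / (m + 1 : ℝ) ^ KU * (p * (cD / (m + 1 : ℝ) ^ KD)) := by
          rw [pow_add]; field_simp
      _ ≤ cU / ((2 * n : ℕ) : ℝ) ^ KU * (p * (cD / (k : ℝ) ^ KD)) := by gcongr

/-- Equation (2.14): polynomial lower bound for the free partition functions:
`Z^p_{0,N} ≥ Z^w_{0,N} ≥ c / N^{2 + c_-}` for every `N ∈ ℕ`. -/
theorem free_partition_function_lower_bound
    (E : ℝ → ℝ) (σ : ℝ)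
    (hE_nonneg : ∀ x, 0 ≤ E x) (hE_cont : Continuous E)
    (hE_bdd : ∃ M, ∀ x, E x ≤ M) (hE_pos : 0 < E 0)
    (hE_int : Integrable E) (hE_mass : ∫ x, E x = 1)
    (hE_mom1 : Integrable fun x => x * E x) (hE_mean : ∫ x, x * E x = 0)
    (hE_mom2 : Integrable fun x => x ^ 2 * E x) (hE_var : ∫ x, x ^ 2 * E x = σ ^ 2)
    (hσ : 0 < σ)
 :
    ∃ c cm : ℝ, 0 < c ∧ 0 < cm ∧ ∀ N : ℕ, 1 ≤ N →
      c / (N : ℝ) ^ ((2 : ℝ) + cm) ≤ Zwet E 0 N ∧ Zwet E 0 N ≤ Zpin E 0 N := by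
  obtain ⟨M, hM⟩ := hE_bdd
  obtain ⟨c, hc, K, h⟩ := exists_pathMass_polynomial_bound hE_nonneg hE_cont hE_pos hE_int
    hE_mass hE_mom1 hE_mean hE_mom2 hE_var hσ
  have hfin : ∀ A m, pathMass E A m 0 0 ≠ ∞ := fun A m =>
    ((pathMass_le hE_nonneg hE_int hE_mass hM A m 0 0).trans_lt ENNReal.ofReal_lt_top).ne
  refine ⟨c, K + 1, hc, by positivity, fun N hN => ?_⟩
  obtain ⟨m, rfl⟩ : ∃ m, N = m + 1 := ⟨N - 1, by omega⟩
  rw [Zwet_zero hE_cont hE_nonneg, Zpin_zero hE_cont hE_nonneg]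
  refine ⟨?_, ENNReal.toReal_mono (hfin _ _) (pathMass_mono_set E (subset_univ _) m 0 0)⟩
  have hm1 : (1 : ℝ) ≤ m + 1 := by linarith [(Nat.cast_nonneg m : (0 : ℝ) ≤ m)]
  refine le_trans ?_ ((ENNReal.ofReal_le_iff_le_toReal (hfin _ _)).1 (h m))
  push_cast
  rw [← Real.rpow_natCast]
  gcongr
  linarith
end
end
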